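/- arXiv:2503.13727 — 2 statements merged into one kernel-verified Lean document; each statement's English description precedes it below -/
import Mathlib

section
/- There exists a set X ⊆ ℕ that is uniformly high for paths but is neither reticently high for paths nor loquaciously high for paths. -/
namespace CFT

open Nat.Partrec (Code)

/-- Relativized partial recursive functions: `f` is partial recursive in the
(total) oracle `O : ℕ → ℕ`.  This mirrors Mathlib's `Nat.Partrec`, with an
extra constructor for the oracle. -/
inductive RecursiveIn (O : ℕ → ℕ) : (ℕ →. ℕ) → Prop
  | zero : RecursiveIn O (pure 0)
  | succ : RecursiveIn O Nat.succ
  | left : RecursiveIn O ↑fun n : ℕ => n.unpair.1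
  | right : RecursiveIn O ↑fun n : ℕ => n.unpair.2
  | oracle : RecursiveIn O ↑O
  | pair {f g} : RecursiveIn O f → RecursiveIn O g →
      RecursiveIn O fun n => Nat.pair <$> f n <*> g n
  | comp {f g} : RecursiveIn O f → RecursiveIn O g →
      RecursiveIn O fun n => g n >>= f
  | prec {f g} : RecursiveIn O f → RecursiveIn O g →
      RecursiveIn O (Nat.unpaired fun a n =>
        n.rec (f a) fun y IH => do let i ← IH; g (Nat.pair a (Nat.pair y i)))
  | rfind {f} : RecursiveIn O f →
      RecursiveIn O fun a => Nat.rfind fun n => (fun m => m = 0) <$> f (Nat.pair a n)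

/-- Partial functions between `Primcodable` types that are partial recursive in
the oracle `O`. -/
def PartrecIn (O : ℕ → ℕ) {α σ : Type} [Primcodable α] [Primcodable σ] (f : α →. σ) : Prop :=
  RecursiveIn O fun n =>
    Part.bind (Part.ofOption (Encodable.decode (α := α) n)) fun a => (f a).map Encodable.encode

/-- Total functions between `Primcodable` types that are computable in the oracle `O`. -/
def ComputableIn (O : ℕ → ℕ) {α σ : Type} [Primcodable α] [Primcodable σ] (f : α → σ) : Prop :=
  PartrecIn O (f : α →. σ)

open Classical in
/-- The characteristic function of a set of naturals. -/
noncomputable def chi (A : Set ℕ) : ℕ → ℕ := fun n => if n ∈ A then 1 else 0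

/-- `A` is computably enumerable in (the characteristic function of) `X`. -/
def CEIn (X : Set ℕ) (A : Set ℕ) : Prop :=
  ∃ f : ℕ →. ℕ, PartrecIn (chi X) f ∧ ∀ n, n ∈ A ↔ (f n).Dom

/-- The `e`-th partial computable function `ℕ →. ℕ`. -/
def codeFn (e : ℕ) : ℕ →. ℕ := (Denumerable.ofNat Code e).eval

/-! ### Trees on ℕ -/

def PrefixClosed (T : Set (List ℕ)) : Prop := ∀ l ∈ T, ∀ l' : List ℕ, l' <+: l → l' ∈ T

/-- Index `e` decides a (prefix-closed) tree on `ℕ`. -/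
def DecidesTree (e : ℕ) : Prop :=
  (∀ n, (codeFn e n).Dom) ∧
    PrefixClosed {l : List ℕ | codeFn e (Encodable.encode l) = Part.some 1}

open Classical in
/-- The standard enumeration of computable trees on ℕ; indices that do not
decide a tree denote the empty tree. -/
noncomputable def treeAt (e : ℕ) : Set (List ℕ) :=
  if DecidesTree e then {l : List ℕ | codeFn e (Encodable.encode l) = Part.some 1} else ∅

/-- `f` is a path through the tree `T`: every finite initial segment
`[f 0, …, f (k-1)]` is in `T`. -/
def IsPath (T : Set (List ℕ)) (f : ℕ → ℕ) : Prop := ∀ k, (List.range k).map f ∈ T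

def IllFounded (T : Set (List ℕ)) : Prop := ∃ f, IsPath T f

/-- The set of indices of well-founded computable trees. -/
def WF : Set ℕ := {e | ¬ IllFounded (treeAt e)}

/-- `T` is a computable tree (prefix-closed and decided by a total computable function). -/
def ComputableTree (T : Set (List ℕ)) : Prop :=
  PrefixClosed T ∧ ∃ χ : List ℕ → Bool, Computable χ ∧ ∀ l, l ∈ T ↔ χ l = true

/-! ### Highness notions for paths -/

def HighForPaths (X : Set ℕ) : Prop :=
  ∀ T : Set (List ℕ), ComputableTree T → IllFounded T →
    ∃ f : ℕ → ℕ, ComputableIn (chi X) f ∧ IsPath T f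

def LoqHighForPaths (X : Set ℕ) : Prop :=
  ∃ F : ℕ × ℕ → ℕ, ComputableIn (chi X) F ∧
    ∀ e, IllFounded (treeAt e) → IsPath (treeAt e) fun n => F (e, n)

def UnifHighForPaths (X : Set ℕ) : Prop :=
  ∃ F : ℕ × ℕ →. ℕ, PartrecIn (chi X) F ∧
    ∀ e, IllFounded (treeAt e) →
      ∃ g : ℕ → ℕ, IsPath (treeAt e) g ∧ ∀ n, F (e, n) = Part.some (g n)

def RetHighForPaths (X : Set ℕ) : Prop :=
  ∃ F : ℕ × ℕ →. ℕ, PartrecIn (chi X) F ∧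
    (∀ e, IllFounded (treeAt e) →
      ∃ g : ℕ → ℕ, IsPath (treeAt e) g ∧ ∀ n, F (e, n) = Part.some (g n)) ∧
    (∀ e, ¬ IllFounded (treeAt e) → ∀ n, ¬ (F (e, n)).Dom)

/-! ### Σ¹₁ and Π¹₁ sets -/

def Sigma11 (A : Set ℕ) : Prop :=
  ∃ R : ℕ → List ℕ → Bool, Computable₂ R ∧
    ∀ n, n ∈ A ↔ ∃ f : ℕ → ℕ, ∀ k, R n ((List.range k).map f) = true

def Pi11 (A : Set ℕ) : Prop := Sigma11 Aᶜ

/-! ### Linear orders -/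

/-- A (presentation of a) linear order: a domain `D ⊆ ℕ` and a strict order
relation on it. -/
structure LinOrd where
  dom : Set ℕ
  lt : ℕ → ℕ → Prop

/-- `L` really is a strict linear order on its domain. -/
def LinOrd.IsValid (L : LinOrd) : Prop :=
  (∀ a b, L.lt a b → a ∈ L.dom ∧ b ∈ L.dom) ∧
  (∀ a, ¬ L.lt a a) ∧
  (∀ a b c, L.lt a b → L.lt b c → L.lt a c) ∧
  (∀ a ∈ L.dom, ∀ b ∈ L.dom, a = b ∨ L.lt a b ∨ L.lt b a)

def linOrdOfCodes (n : ℕ) : LinOrd :=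
  ⟨{a | codeFn n.unpair.1 a = Part.some 1},
   fun a b => codeFn n.unpair.2 (Nat.pair a b) = Part.some 1⟩

def DecidesLinOrd (n : ℕ) : Prop :=
  (∀ m, (codeFn n.unpair.1 m).Dom) ∧ (∀ m, (codeFn n.unpair.2 m).Dom) ∧
    (linOrdOfCodes n).IsValid

open Classical in
/-- The standard enumeration of computable linear orders; indices that do not
decide a linear order denote the empty order. -/
noncomputable def linOrdAt (n : ℕ) : LinOrd :=
  if DecidesLinOrd n then linOrdOfCodes n else ⟨∅, fun _ _ => False⟩

def IsDescSeq (L : LinOrd) (f : ℕ → ℕ) : Prop :=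
  ∀ i, f i ∈ L.dom ∧ L.lt (f (i + 1)) (f i)

def LinOrd.IllFounded (L : LinOrd) : Prop := ∃ f, IsDescSeq L f

/-- A tight descending sequence: a descending sequence that gets below every
descending sequence. -/
def IsTightDescSeq (L : LinOrd) (f : ℕ → ℕ) : Prop :=
  IsDescSeq L f ∧ ∀ g, IsDescSeq L g → ∀ n, ∃ m, L.lt (f m) (g n)

/-- `L` is a computable linear order. -/
def ComputableLinOrd (L : LinOrd) : Prop :=
  L.IsValid ∧
  (∃ χ : ℕ → Bool, Computable χ ∧ ∀ a, a ∈ L.dom ↔ χ a = true) ∧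
  (∃ χ : ℕ → ℕ → Bool, Computable₂ χ ∧ ∀ a b, L.lt a b ↔ χ a b = true)

def LoqHighForDS (X : Set ℕ) : Prop :=
  ∃ g : ℕ × ℕ → ℕ, ComputableIn (chi X) g ∧
    ∀ n, (linOrdAt n).IllFounded → IsDescSeq (linOrdAt n) fun k => g (n, k)

def HighForTightDS (X : Set ℕ) : Prop :=
  ∀ L : LinOrd, ComputableLinOrd L → L.IllFounded →
    ∃ f : ℕ → ℕ, ComputableIn (chi X) f ∧ IsTightDescSeq L f

def UnifHighForTightDS (X : Set ℕ) : Prop :=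
  ∃ F : ℕ × ℕ →. ℕ, PartrecIn (chi X) F ∧
    ∀ n, (linOrdAt n).IllFounded →
      ∃ g : ℕ → ℕ, IsTightDescSeq (linOrdAt n) g ∧ ∀ k, F (n, k) = Part.some (g k)

/-! ### Binary trees -/

def PrefixClosedB (B : Set (List Bool)) : Prop := ∀ l ∈ B, ∀ l' : List Bool, l' <+: l → l' ∈ B

def DecidesBTree (e : ℕ) : Prop :=
  (∀ n, (codeFn e n).Dom) ∧
    PrefixClosedB {l : List Bool | codeFn e (Encodable.encode l) = Part.some 1}

open Classical in
/-- The standard enumeration of computable binary trees; indices that do not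
decide a binary tree denote the full binary tree. -/
noncomputable def bTreeAt (e : ℕ) : Set (List Bool) :=
  if DecidesBTree e then {l : List Bool | codeFn e (Encodable.encode l) = Part.some 1}
  else Set.univ

def BInfinite (B : Set (List Bool)) : Prop := ∀ k, ∃ l ∈ B, l.length = k

def IsBPath (B : Set (List Bool)) (p : ℕ → Bool) : Prop := ∀ k, (List.range k).map p ∈ B

/-- The stage-`k` approximation to a witness `w` and a real parameter `ρ`. -/
def approx {γ : Type} (w : ℕ → ℕ) (ρ : ℕ → γ) (k : ℕ) : List (ℕ × γ) :=
  (List.range (k + 1)).map fun i => (w i, ρ i)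

theorem approx_getElem? {γ : Type} (w : ℕ → ℕ) (ρ : ℕ → γ) (k i : ℕ) :
    (approx w ρ k)[i]? = if i ≤ k then some (w i, ρ i) else none := by
  simp only [approx, List.getElem?_map]
  split_ifs with h
  · rw [List.getElem?_range (by omega)]; rfl
  · simp; omega

theorem approx_map (f : ℕ → ℕ) {γ δ : Type} (g : γ → δ) (w : ℕ → ℕ) (ρ : ℕ → γ) (k : ℕ) :
    (approx w ρ k).map (fun x => (f x.1, g x.2)) =
      approx (fun i => f (w i)) (fun i => g (ρ i)) k := by
  simp [approx, Function.comp_def]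

theorem approx_map' {γ δ : Type} (f : ℕ × γ → ℕ × δ) (w : ℕ → ℕ) (ρ : ℕ → γ) (k : ℕ) :
    (approx w ρ k).map f = approx (fun i => (f (w i, ρ i)).1) (fun i => (f (w i, ρ i)).2) k := by
  simp [approx, Function.comp_def]

theorem approx_head? {γ : Type} (w : ℕ → ℕ) (ρ : ℕ → γ) (k : ℕ) :
    (approx w ρ k).head? = some (w 0, ρ 0) := by
  simp [approx, List.range_succ_eq_map]

/-- `P` has a normal form as a (lightface) `Σ¹₁` relation of `a : α` and the real `ρ : ℕ → γ`. -/
def NF {α γ : Type} [Primcodable α] [Primcodable γ] (P : α → (ℕ → γ) → Prop) : Prop :=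
  ∃ χ : α × List (ℕ × γ) → Bool, Computable χ ∧
    ∀ a ρ, P a ρ ↔ ∃ w : ℕ → ℕ, ∀ k, χ (a, approx w ρ k) = true

section Closure

variable {α β γ δ : Type} [Primcodable α] [Primcodable β] [Primcodable γ] [Primcodable δ]

theorem NF.congr {P Q : α → (ℕ → γ) → Prop} (h : NF P) (e : ∀ a ρ, P a ρ ↔ Q a ρ) : NF Q := by
  obtain rfl : P = Q := by funext a ρ; exact propext (e a ρ)
  exact h

theorem NF.of_computable {c : α → Bool} (hc : Computable c) :
    NF (γ := γ) fun a _ => c a = true :=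
  ⟨fun x => c x.1, hc.comp Computable.fst, fun _ _ => ⟨fun h => ⟨fun _ => 0, fun _ => h⟩,
    fun ⟨_, h⟩ => h 0⟩⟩

theorem NF.subst {P : β → (ℕ → γ) → Prop} (h : NF P) {u : α → β} (hu : Computable u) :
    NF fun a ρ => P (u a) ρ := by
  obtain ⟨χ, hχ, e⟩ := h
  exact ⟨fun x => χ (u x.1, x.2),
    hχ.comp (Computable.pair (hu.comp Computable.fst) Computable.snd), fun a ρ => e (u a) ρ⟩

theorem NF.rsubst {P : α → (ℕ → δ) → Prop} (h : NF P) {g : γ → δ} (hg : Primrec g) :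
    NF fun a ρ => P a (fun n => g (ρ n)) := by
  obtain ⟨χ, hχ, e⟩ := h
  have hm : Primrec fun x : α × List (ℕ × γ) => x.2.map fun y => (y.1, g y.2) :=
    Primrec.list_map Primrec.snd
      ((Primrec.pair (Primrec.fst.comp Primrec.snd)
        (hg.comp (Primrec.snd.comp Primrec.snd))).to₂)
  refine ⟨fun x => χ (x.1, x.2.map fun y => (y.1, g y.2)),
    hχ.comp (Computable.pair Computable.fst hm.to_comp), fun a ρ => ?_⟩
  simp only [e]
  have (w : ℕ → ℕ) (k : ℕ) := approx_map id g w ρ k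
  simp only [id] at this
  simp only [this]

theorem NF.and {P Q : α → (ℕ → γ) → Prop} (hP : NF P) (hQ : NF Q) :
    NF fun a ρ => P a ρ ∧ Q a ρ := by
  obtain ⟨χ, hχ, e⟩ := hP
  obtain ⟨χ', hχ', e'⟩ := hQ
  have h1 : Primrec fun x : α × List (ℕ × γ) => x.2.map fun y => (y.1.unpair.1, y.2) :=
    Primrec.list_map Primrec.snd
      ((Primrec.pair (Primrec.fst.comp (Primrec.unpair.comp (Primrec.fst.comp Primrec.snd)))
        (Primrec.snd.comp Primrec.snd)).to₂)
  have h2 : Primrec fun x : α × List (ℕ × γ) => x.2.map fun y => (y.1.unpair.2, y.2) :=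
    Primrec.list_map Primrec.snd
      ((Primrec.pair (Primrec.snd.comp (Primrec.unpair.comp (Primrec.fst.comp Primrec.snd)))
        (Primrec.snd.comp Primrec.snd)).to₂)
  refine ⟨fun x => χ (x.1, x.2.map fun y => (y.1.unpair.1, y.2)) &&
      χ' (x.1, x.2.map fun y => (y.1.unpair.2, y.2)),
    Primrec.and.to_comp.comp (hχ.comp (Computable.pair Computable.fst h1.to_comp))
      (hχ'.comp (Computable.pair Computable.fst h2.to_comp)), fun a ρ => ?_⟩
  simp only [e, e']
  have t1 (w : ℕ → ℕ) (k : ℕ) := approx_map (fun n => n.unpair.1) id w ρ k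
  have t2 (w : ℕ → ℕ) (k : ℕ) := approx_map (fun n => n.unpair.2) id w ρ k
  simp only [id] at t1 t2
  simp only [t1, t2, Bool.and_eq_true]
  constructor
  · rintro ⟨⟨w, hw⟩, ⟨w', hw'⟩⟩
    exact ⟨fun n => Nat.pair (w n) (w' n), fun k => by simpa using ⟨hw k, hw' k⟩⟩
  · rintro ⟨w, hw⟩
    exact ⟨⟨_, fun k => (hw k).1⟩, ⟨_, fun k => (hw k).2⟩⟩

theorem NF.ex {P : α × β → (ℕ → γ) → Prop} (hP : NF P) :
    NF fun a ρ => ∃ b, P (a, b) ρ := by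
  obtain ⟨χ, hχ, e⟩ := hP
  have h2 : Primrec fun x : α × List (ℕ × γ) => x.2.map fun y => (y.1.unpair.2, y.2) :=
    Primrec.list_map Primrec.snd
      ((Primrec.pair (Primrec.snd.comp (Primrec.unpair.comp (Primrec.fst.comp Primrec.snd)))
        (Primrec.snd.comp Primrec.snd)).to₂)
  have hd : Primrec fun x : α × List (ℕ × γ) =>
      (x.2.head?).bind fun y => Encodable.decode (α := β) y.1.unpair.1 :=
    Primrec.option_bind (Primrec.list_head?.comp Primrec.snd)
      ((Primrec.decode.comp (Primrec.fst.comp (Primrec.unpair.comp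
        (Primrec.fst.comp Primrec.snd)))).to₂)
  refine ⟨fun x => ((((x.2.head?).bind fun y => Encodable.decode (α := β) y.1.unpair.1).map
      fun b => χ ((x.1, b), x.2.map fun y => (y.1.unpair.2, y.2))).getD false), ?_,
    fun a ρ => ?_⟩
  · refine Computable.option_getD (Computable.option_map hd.to_comp ?_) (Computable.const _)
    exact (hχ.comp (Computable.pair (Computable.pair (Computable.fst.comp Computable.fst)
      Computable.snd) (h2.to_comp.comp Computable.fst))).to₂
  · have t2 (w : ℕ → ℕ) (k : ℕ) := approx_map (fun n => n.unpair.2) id w ρ k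
    simp only [id] at t2
    simp only [t2, approx_head?, Option.bind_some]
    constructor
    · rintro ⟨b, hb⟩
      obtain ⟨w, hw⟩ := (e _ _).1 hb
      exact ⟨fun n => Nat.pair (Encodable.encode b) (w n), fun k => by simpa using hw k⟩
    · rintro ⟨w, hw⟩
      cases hb : Encodable.decode (α := β) (w 0).unpair.1 with
      | none => simp [hb] at hw
      | some b => exact ⟨b, (e _ _).2 ⟨_, fun k => by simpa [hb] using hw k⟩⟩

theorem NF.exReal {P : α → (ℕ → ℕ × γ) → Prop} (hP : NF P) :
    NF fun a ρ => ∃ f : ℕ → ℕ, P a (fun n => (f n, ρ n)) := by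
  obtain ⟨χ, hχ, e⟩ := hP
  have h2 : Primrec fun x : α × List (ℕ × γ) =>
      x.2.map fun y => (y.1.unpair.2, (y.1.unpair.1, y.2)) :=
    Primrec.list_map Primrec.snd
      ((Primrec.pair (Primrec.snd.comp (Primrec.unpair.comp (Primrec.fst.comp Primrec.snd)))
        (Primrec.pair (Primrec.fst.comp (Primrec.unpair.comp (Primrec.fst.comp Primrec.snd)))
        (Primrec.snd.comp Primrec.snd))).to₂)
  refine ⟨fun x => χ (x.1, x.2.map fun y => (y.1.unpair.2, (y.1.unpair.1, y.2))),
    hχ.comp (Computable.pair Computable.fst h2.to_comp), fun a ρ => ?_⟩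
  simp only [e, approx_map']
  constructor
  · rintro ⟨f, w, hw⟩
    exact ⟨fun n => Nat.pair (f n) (w n), fun k => by simpa using hw k⟩
  · rintro ⟨w, hw⟩
    exact ⟨_, _, hw⟩

theorem NF.or {P Q : α → (ℕ → γ) → Prop} (hP : NF P) (hQ : NF Q) :
    NF fun a ρ => P a ρ ∨ Q a ρ := by
  obtain ⟨χ, hχ, e⟩ := hP
  obtain ⟨χ', hχ', e'⟩ := hQ
  have key : NF fun (x : α × Bool) (ρ : ℕ → γ) => cond x.2 (P x.1 ρ) (Q x.1 ρ) := by
    refine ⟨fun x => cond x.1.2 (χ (x.1.1, x.2)) (χ' (x.1.1, x.2)), ?_, ?_⟩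
    · exact Computable.cond (Computable.snd.comp Computable.fst)
        (hχ.comp (Computable.pair (Computable.fst.comp Computable.fst) Computable.snd))
        (hχ'.comp (Computable.pair (Computable.fst.comp Computable.fst) Computable.snd))
    · rintro ⟨a, b⟩ ρ
      cases b <;> simp [e, e']
  refine key.ex.congr fun a ρ => ?_
  simp [or_comm]

theorem NF.all {P : α × β → (ℕ → γ) → Prop} (hP : NF P) :
    NF fun a ρ => ∀ b, P (a, b) ρ := by
  obtain ⟨χ, hχ, e⟩ := hP
  let gather : List (ℕ × γ) → ℕ → ℕ → List (ℕ × γ) := fun l n k' =>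
    (List.range (k' + 1)).filterMap fun i =>
      (l[Nat.pair n i]?).bind fun x => (l[i]?).map fun y => (x.1, y.2)
  have hg : Primrec fun x : List (ℕ × γ) × ℕ × ℕ => gather x.1 x.2.1 x.2.2 := by
    refine Primrec.listFilterMap (Primrec.list_range.comp
      (Primrec.succ.comp (Primrec.snd.comp Primrec.snd))) ?_
    refine Primrec.option_bind (Primrec.list_getElem?.comp (Primrec.fst.comp Primrec.fst)
      (Primrec₂.natPair.comp (Primrec.fst.comp (Primrec.snd.comp Primrec.fst)) Primrec.snd)) ?_
    refine Primrec.option_map (Primrec.list_getElem?.comp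
      (Primrec.fst.comp (Primrec.fst.comp Primrec.fst)) (Primrec.snd.comp Primrec.fst)) ?_
    exact Primrec.pair (Primrec.fst.comp (Primrec.snd.comp Primrec.fst))
      (Primrec.snd.comp Primrec.snd)
  have gather_eq (w : ℕ → ℕ) (ρ : ℕ → γ) (n k' : ℕ) :
      gather (approx w ρ (Nat.pair n k')) n k' = approx (fun i => w (Nat.pair n i)) ρ k' := by
    have : ∀ i ∈ List.range (k' + 1),
        ((approx w ρ (Nat.pair n k'))[Nat.pair n i]?).bind (fun x =>
          ((approx w ρ (Nat.pair n k'))[i]?).map fun y => (x.1, y.2)) =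
        some (w (Nat.pair n i), ρ i) := by
      intro i hi
      have hi : i ≤ k' := by simpa [Nat.lt_succ_iff] using hi
      have h1 : Nat.pair n i ≤ Nat.pair n k' := by
        rcases hi.eq_or_lt with rfl | h
        · rfl
        · exact (Nat.pair_lt_pair_right n h).le
      have h2 : i ≤ Nat.pair n k' := hi.trans (Nat.right_le_pair n k')
      simp [approx_getElem?, h1, h2]
    simp only [gather]
    rw [List.filterMap_congr this]
    simp [approx]
  have hK : Primrec fun x : α × List (ℕ × γ) => (x.2.length - 1).unpair :=
    Primrec.unpair.comp (Primrec.nat_sub.comp (Primrec.list_length.comp Primrec.snd)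
      (Primrec.const 1))
  refine ⟨fun x => ((Encodable.decode (α := β) (x.2.length - 1).unpair.1).map fun b =>
      χ ((x.1, b), gather x.2 (x.2.length - 1).unpair.1 (x.2.length - 1).unpair.2)).getD true,
      ?_, fun a ρ => ?_⟩
  · refine Computable.option_getD (Computable.option_map
      (Primrec.decode.comp (Primrec.fst.comp hK)).to_comp ?_) (Computable.const _)
    refine (hχ.comp (Computable.pair (Computable.pair (Computable.fst.comp Computable.fst)
      Computable.snd) ((hg.comp (Primrec.pair Primrec.snd hK)).to_comp.comp
        Computable.fst))).to₂
  · have hl (w : ℕ → ℕ) (k : ℕ) : (approx w ρ k).length - 1 = k := by simp [approx]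
    simp only [hl]
    constructor
    · intro h
      choose w hw using fun b => (e (a, b) ρ).1 (h b)
      refine ⟨fun m => ((Encodable.decode (α := β) m.unpair.1).map
        fun b => w b m.unpair.2).getD 0, fun k => ?_⟩
      cases hb : Encodable.decode (α := β) k.unpair.1 with
      | none => simp
      | some b =>
        have := gather_eq (fun m => ((Encodable.decode (α := β) m.unpair.1).map
          fun b => w b m.unpair.2).getD 0) ρ k.unpair.1 k.unpair.2
        simp only [Nat.pair_unpair, Nat.unpair_pair, hb, Option.map_some, Option.getD_some] at this
        simp only [Option.map_some, Option.getD_some, this]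
        exact hw b _
    · rintro ⟨w, hw⟩ b
      refine (e _ _).2 ⟨fun i => w (Nat.pair (Encodable.encode b) i), fun k => ?_⟩
      have := hw (Nat.pair (Encodable.encode b) k)
      simpa [gather_eq] using this

theorem NF.eval_eq [DecidableEq γ] {u : α → ℕ} (hu : Computable u) :
    NF fun (x : α × γ) (ρ : ℕ → γ) => ρ (u x.1) = x.2 := by
  refine ⟨fun x => ((x.2[u x.1.1]?).map fun y => decide (y.2 = x.1.2)).getD true, ?_, ?_⟩
  · refine Computable.option_getD (Computable.option_map
      (Primrec.list_getElem?.to_comp.comp Computable.snd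
        (hu.comp (Computable.fst.comp Computable.fst))) ?_) (Computable.const _)
    exact ((Primrec.eq (α := γ)).decide.to_comp.comp (Computable.snd.comp Computable.snd)
      (Computable.snd.comp (Computable.fst.comp Computable.fst))).to₂
  · rintro ⟨a, v⟩ ρ
    simp only [approx_getElem?]
    constructor
    · rintro rfl
      refine ⟨fun _ => 0, fun k => ?_⟩
      split_ifs <;> simp
    · rintro ⟨w, hw⟩
      simpa using hw (u a)

theorem NF.read [DecidableEq γ] {P : α × γ → (ℕ → γ) → Prop} (hP : NF P) {u : α → ℕ}
    (hu : Computable u) : NF fun a ρ => P (a, ρ (u a)) ρ :=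
  ((NF.eval_eq hu).and hP).ex.congr fun a ρ => by simp

/-- `P` is (lightface) `Δ¹₁`. -/
def Del (P : α → Prop) : Prop :=
  NF (γ := Unit) (fun a _ => P a) ∧ NF (γ := Unit) (fun a _ => ¬ P a)

theorem NF.lift {P : α → Prop} (h : NF (γ := Unit) fun a _ => P a) : NF (γ := γ) fun a _ => P a :=
  h.rsubst (g := fun _ : γ => ()) (Primrec.const _)

theorem Del.nf {P : α → Prop} (h : Del P) : NF (γ := γ) fun a _ => P a := NF.lift h.1

theorem Del.congr {P Q : α → Prop} (h : Del P) (e : ∀ a, P a ↔ Q a) : Del Q := by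
  obtain rfl : P = Q := by funext a; exact propext (e a)
  exact h

theorem Del.not {P : α → Prop} (h : Del P) : Del fun a => ¬ P a :=
  ⟨h.2, h.1.congr fun a _ => by simp⟩

theorem Del.nfnot {P : α → Prop} (h : Del P) : NF (γ := γ) fun a _ => ¬ P a := h.not.nf

theorem Del.and {P Q : α → Prop} (h : Del P) (h' : Del Q) : Del fun a => P a ∧ Q a :=
  ⟨h.1.and h'.1, (h.2.or h'.2).congr fun a _ => by tauto⟩

theorem Del.or {P Q : α → Prop} (h : Del P) (h' : Del Q) : Del fun a => P a ∨ Q a :=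
  ⟨h.1.or h'.1, (h.2.and h'.2).congr fun a _ => by tauto⟩

theorem Del.imp {P Q : α → Prop} (h : Del P) (h' : Del Q) : Del fun a => P a → Q a :=
  (h.not.or h').congr fun a => by tauto

theorem Del.ex {P : α × β → Prop} (h : Del P) : Del fun a => ∃ b, P (a, b) :=
  ⟨NF.ex h.1, (NF.all h.2).congr fun a _ => by simp⟩

theorem Del.all {P : α × β → Prop} (h : Del P) : Del fun a => ∀ b, P (a, b) :=
  ⟨NF.all h.1, (NF.ex h.2).congr fun a _ => by simp⟩

theorem Del.subst {P : β → Prop} (h : Del P) {u : α → β} (hu : Computable u) :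
    Del fun a => P (u a) := ⟨h.1.subst hu, h.2.subst hu⟩

theorem Del.of_computable {c : α → Bool} (hc : Computable c) : Del fun a => c a = true :=
  ⟨NF.of_computable hc, (NF.of_computable (Primrec.not.to_comp.comp hc)).congr
    fun a _ => by simp⟩

theorem Del.const (p : Prop) : Del fun _ : α => p := by
  by_cases h : p
  · exact (Del.of_computable (Computable.const true)).congr fun _ => by simp [h]
  · exact (Del.of_computable (Computable.const false)).congr fun _ => by simp [h]

theorem Del.eq [DecidableEq β] {u v : α → β} (hu : Computable u) (hv : Computable v) :
    Del fun a => u a = v a :=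
  (Del.of_computable ((Primrec.eq (α := β)).decide.to_comp.comp hu hv)).congr fun _ => by simp

theorem Del.le {u v : α → ℕ} (hu : Computable u) (hv : Computable v) :
    Del fun a => u a ≤ v a :=
  (Del.of_computable (Primrec.nat_le.decide.to_comp.comp hu hv)).congr fun _ => by simp

theorem Del.finite [DecidableEq α] {s : Set α} (hs : s.Finite) : Del fun a => a ∈ s := by
  induction s, hs using Set.Finite.induction_on with
  | empty => exact (Del.const False).congr fun a => by simp
  | @insert a s _ _ ih =>
    exact ((Del.eq Computable.id (Computable.const a)).or ih).congr fun b => by simp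

end Closure

attribute [fun_prop] Computable Computable.id Computable.const Computable.comp Computable.pair

section ComputableLemmas

variable {α β γ δ : Type} [Primcodable α] [Primcodable β] [Primcodable γ] [Primcodable δ]

@[fun_prop]
theorem computable_fst {f : α → β × γ} (hf : Computable f) : Computable fun a => (f a).1 :=
  Computable.fst.comp hf

@[fun_prop]
theorem computable_snd {f : α → β × γ} (hf : Computable f) : Computable fun a => (f a).2 :=
  Computable.snd.comp hf

@[fun_prop]
theorem computable_natPair {f g : α → ℕ} (hf : Computable f) (hg : Computable g) :
    Computable fun a => Nat.pair (f a) (g a) :=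
  Primrec₂.natPair.to_comp.comp hf hg

@[fun_prop]
theorem computable_unpair {f : α → ℕ} (hf : Computable f) : Computable fun a => (f a).unpair :=
  Computable.unpair.comp hf

@[fun_prop]
theorem computable_append {f g : α → List β} (hf : Computable f) (hg : Computable g) :
    Computable fun a => f a ++ g a :=
  Computable.list_append.comp hf hg

@[fun_prop]
theorem computable_cons {f : α → β} {g : α → List β} (hf : Computable f) (hg : Computable g) :
    Computable fun a => f a :: g a :=
  Computable.list_cons.comp hf hg

@[fun_prop]
theorem computable_length {f : α → List β} (hf : Computable f) :
    Computable fun a => (f a).length :=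
  Computable.list_length.comp hf

@[fun_prop]
theorem computable_encode {f : α → β} (hf : Computable f) :
    Computable fun a => Encodable.encode (f a) :=
  Computable.encode.comp hf

@[fun_prop]
theorem computable_some {f : α → β} (hf : Computable f) : Computable fun a => some (f a) :=
  Computable.option_some.comp hf

@[fun_prop]
theorem computable_getElem? {f : α → List β} {g : α → ℕ} (hf : Computable f)
    (hg : Computable g) : Computable fun a => (f a)[g a]? :=
  Primrec.list_getElem?.to_comp.comp hf hg

@[fun_prop]
theorem computable_take {f : α → ℕ} {g : α → List β} (hf : Computable f)
    (hg : Computable g) : Computable fun a => (g a).take (f a) :=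
  Primrec.list_take.to_comp.comp hf hg

theorem NF.exists {P : α → β → (ℕ → γ) → Prop} (h : NF fun (x : α × β) ρ => P x.1 x.2 ρ) :
    NF fun a ρ => ∃ b, P a b ρ := NF.ex (P := fun x ρ => P x.1 x.2 ρ) h

theorem NF.forall {P : α → β → (ℕ → γ) → Prop} (h : NF fun (x : α × β) ρ => P x.1 x.2 ρ) :
    NF fun a ρ => ∀ b, P a b ρ := NF.all (P := fun x ρ => P x.1 x.2 ρ) h

theorem Del.exists {P : α → β → Prop} (h : Del fun x : α × β => P x.1 x.2) :
    Del fun a => ∃ b, P a b := Del.ex (P := fun x => P x.1 x.2) h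

theorem Del.forall {P : α → β → Prop} (h : Del fun x : α × β => P x.1 x.2) :
    Del fun a => ∀ b, P a b := Del.all (P := fun x => P x.1 x.2) h

theorem Del.isPrefix [DecidableEq β] {u v : α → List β} (hu : Computable u) (hv : Computable v) :
    Del fun a => u a <+: v a :=
  (Del.eq (u := u) (v := fun a => (v a).take (u a).length) (by fun_prop)
    (by fun_prop)).congr fun a => List.prefix_iff_eq_take.symm

theorem Del.mem_codeFn {e n v : α → ℕ} (he : Computable e) (hn : Computable n)
    (hv : Computable v) : Del fun a => v a ∈ codeFn (e a) (n a) := by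
  have hc : Computable fun x : α × ℕ => Code.evaln x.2 (Denumerable.ofNat Code (e x.1)) (n x.1) :=
    Nat.Partrec.Code.primrec_evaln.to_comp.comp (Computable.pair (Computable.pair Computable.snd
      ((Computable.ofNat Code).comp (he.comp Computable.fst))) (hn.comp Computable.fst))
  refine Del.congr (Del.ex (Del.eq hc
    (v := fun x => some (v x.1)) (by fun_prop))) fun a => ?_
  exact (Code.evaln_complete (c := Denumerable.ofNat Code (e a)) (n := n a) (x := v a)).symm

theorem mem_treeAt {e : ℕ} {l : List ℕ} :
    l ∈ treeAt e ↔ DecidesTree e ∧ 1 ∈ codeFn e (Encodable.encode l) := by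
  unfold treeAt
  split_ifs with h
  · simp [h, Part.eq_some_iff]
  · simp [h]

theorem treeAt_prefixClosed (e : ℕ) : PrefixClosed (treeAt e) := by
  intro l hl l' h
  rw [mem_treeAt] at hl ⊢
  exact ⟨hl.1, Part.eq_some_iff.1 (hl.1.2 l (Part.eq_some_iff.2 hl.2) l' h)⟩

theorem Del.mem_treeAt {e : α → ℕ} {l : α → List ℕ} (he : Computable e) (hl : Computable l) :
    Del fun a => l a ∈ treeAt (e a) := by
  have h : Del fun a => DecidesTree (e a) ∧ 1 ∈ codeFn (e a) (Encodable.encode (l a)) := by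
    refine Del.and ?_ (Del.mem_codeFn he (by fun_prop) (by fun_prop))
    refine Del.and ?_ ?_
    · refine Del.forall ((Del.exists (P := fun (x : α × ℕ) v => v ∈ codeFn (e x.1) x.2) ?_).congr
        fun x => Part.dom_iff_mem.symm)
      exact Del.mem_codeFn (by fun_prop) (by fun_prop) (by fun_prop)
    · refine Del.forall (Del.imp ?_ (Del.forall (Del.imp
        (Del.isPrefix (by fun_prop) (by fun_prop)) ?_)))
      · exact (Del.mem_codeFn (by fun_prop) (n := fun x => Encodable.encode x.2)
          (by fun_prop) (Computable.const 1)).congr fun a => Part.eq_some_iff.symm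
      · exact (Del.mem_codeFn (by fun_prop) (n := fun x => Encodable.encode x.2)
          (by fun_prop) (Computable.const 1)).congr fun a => Part.eq_some_iff.symm
  exact h.congr fun a => CFT.mem_treeAt.symm

theorem approx_of_list {l : List ℕ} {k : ℕ} (w : ℕ → ℕ)
    (hl : ∀ i ≤ k, l.getD i 0 = w i) :
    (List.range (k + 1)).map (fun i => (l.getD i 0, ())) = approx w (fun _ => ()) k := by
  simp only [approx]
  refine List.map_congr_left fun i hi => ?_
  rw [hl i (by simpa [Nat.lt_succ_iff] using hi)]

theorem exists_treeAt_iff {P : ℕ → Prop} (h : NF (γ := Unit) fun e _ => P e) :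
    ∃ e, IllFounded (treeAt e) ↔ P e := by
  obtain ⟨χ, hχ, hP⟩ := h
  let test : Code → List ℕ → ℕ → Bool := fun c l k =>
    χ (Encodable.encode c, (List.range (k + 1)).map fun i => (l.getD i 0, ()))
  let all : Code → List ℕ → ℕ → Bool := fun c l n =>
    n.rec true fun k b => b && test c l k
  have all_iff (c l n) : all c l n = true ↔ ∀ k < n, test c l k = true := by
    induction n with
    | zero => simp [all]
    | succ n ih =>
      have : all c l (n + 1) = (all c l n && test c l n) := rfl
      rw [this, Bool.and_eq_true, ih, Nat.forall_lt_succ_right]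
  have htest : Computable fun x : (Code × List ℕ) × ℕ => test x.1.1 x.1.2 x.2 := by
    refine hχ.comp (Computable.pair (by fun_prop) (Primrec.to_comp ?_))
    refine Primrec.list_map (Primrec.list_range.comp (Primrec.succ.comp Primrec.snd)) ?_
    exact Primrec.pair ((Primrec.list_getD 0).comp (Primrec.snd.comp (Primrec.fst.comp
      Primrec.fst)) Primrec.snd) (Primrec.const ())
  have hall : Computable fun x : Code × List ℕ => all x.1 x.2 x.2.length := by
    refine Computable.nat_rec (f := fun x : Code × List ℕ => x.2.length) (g := fun _ => true)
      (h := fun (x : Code × List ℕ) (y : ℕ × Bool) => y.2 && test x.1 x.2 y.1) (by fun_prop)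
      (by fun_prop) ?_
    exact Primrec.and.to_comp.comp (by fun_prop) (htest.comp (g := fun x :
       (Code × List ℕ) × (ℕ × Bool) => (x.1, x.2.1))
      (by fun_prop))
  let f : Code → ℕ → ℕ := fun c m =>
    cond (all c (Denumerable.ofNat (List ℕ) m) (Denumerable.ofNat (List ℕ) m).length) 1 0
  have hf : Computable₂ f := by
    refine Computable.cond (hall.comp (g := fun x : Code × ℕ =>
      (x.1, Denumerable.ofNat (List ℕ) x.2)) ?_) (Computable.const 1) (Computable.const 0)
    exact Computable.pair (by fun_prop) ((Computable.ofNat (List ℕ)).comp Computable.snd)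
  obtain ⟨c, hc⟩ := Code.fixed_point₂ (f := fun c m => Part.some (f c m)) hf.partrec
  refine ⟨Encodable.encode c, ?_⟩
  have hcode (m : ℕ) : codeFn (Encodable.encode c) m = Part.some (f c m) := by
    simp [codeFn, hc]
  have hone (l : List ℕ) : codeFn (Encodable.encode c) (Encodable.encode l) = Part.some 1 ↔
      ∀ k < l.length, test c l k = true := by
    rw [hcode, ← all_iff, Part.some_inj]
    cases h : all c l l.length <;> simp [f, h]
  have hdec : DecidesTree (Encodable.encode c) := by
    refine ⟨fun m => by rw [hcode]; trivial, fun l hl l' hp => ?_⟩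
    simp only [Set.mem_ofPred_eq, hone] at hl ⊢
    intro k hk
    rw [← hl k (hk.trans_le hp.length_le)]
    simp only [test]
    congr 2
    refine List.map_congr_left fun i hi => ?_
    have hi : i < l'.length := by
      have : i < k + 1 := by simpa using hi
      omega
    rw [List.getD_eq_getElem?_getD, List.getD_eq_getElem?_getD,
      List.prefix_iff_getElem?.1 hp i hi]
    simp [hi]
  have hmem (l : List ℕ) : l ∈ treeAt (Encodable.encode c) ↔ ∀ k < l.length, test c l k = true := by
    rw [← hone, treeAt, if_pos hdec]; rfl
  refine Iff.trans ?_ (hP (Encodable.encode c) fun _ => ()).symm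
  refine exists_congr fun w => ?_
  have hw (n k : ℕ) (hk : k < n) : test c ((List.range n).map w) k =
      χ (Encodable.encode c, approx w (fun _ => ()) k) := by
    simp only [test]
    rw [approx_of_list w fun i hi => ?_]
    have : i < n := by omega
    simp [List.getD_eq_getElem?_getD, this]
  simp only [IsPath, hmem, List.length_map, List.length_range]
  refine ⟨fun h k => ?_, fun h n k hk => ?_⟩
  · rw [← hw (k + 1) k (by omega)]; exact h _ _ (by omega)
  · rw [hw n k hk]; exact h k

/-- The set of indices of well-founded trees is not `Σ¹₁`. -/
theorem not_nf_wf : ¬ NF (γ := Unit) fun e _ => ¬ IllFounded (treeAt e) := fun h => by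
  obtain ⟨e, he⟩ := exists_treeAt_iff h
  tauto

end ComputableLemmas

section Trees

variable {α β γ : Type} [Primcodable α] [Primcodable β] [Primcodable γ]

theorem Del.atReal [DecidableEq γ] {P : α → γ → Prop} (h : Del fun x : α × γ => P x.1 x.2)
    {u : α → ℕ} (hu : Computable u) : NF fun a (ρ : ℕ → γ) => P a (ρ (u a)) :=
  NF.read (P := fun x _ => P x.1 x.2) h.nf hu

theorem exists_seq_of_forall_exists {α : Type} {Q : List α → Prop} (h0 : Q [])
    (h : ∀ a, Q a → ∃ x, Q (a ++ [x])) : ∃ f : ℕ → α, ∀ k, Q ((List.range k).map f) := by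
  choose next hnext using h
  let b : ℕ → {a // Q a} := fun k =>
    k.rec ⟨[], h0⟩ fun _ a => ⟨a.1 ++ [next a.1 a.2], hnext a.1 a.2⟩
  refine ⟨fun k => next (b k).1 (b k).2, fun k => ?_⟩
  have : (List.range k).map (fun k => next (b k).1 (b k).2) = (b k).1 := by
    induction k with
    | zero => rfl
    | succ k ih => rw [List.range_succ, List.map_append, ih]; rfl
  rw [this]
  exact (b k).2

theorem illFounded_of_forall_exists {T : Set (List ℕ)} {Q : List ℕ → Prop} (h0 : Q [])
    (h : ∀ a, Q a → a ∈ T ∧ ∃ n, Q (a ++ [n])) : IllFounded T :=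
  (exists_seq_of_forall_exists h0 fun a ha => (h a ha).2).imp fun _ hf k => (h _ (hf k)).1

/-- A level-preserving simulation of `A` in `B`. -/
def Simulates (A B : Set (List ℕ)) (P : List ℕ → List ℕ → Prop) : Prop :=
  ∀ a b, P a b → a ∈ A → b ∈ B ∧ ∀ n, ∃ m, P (a ++ [n]) (b ++ [m])

/-- `A` can be simulated in `B`. For trees this says that the rank of `A` is at most that
of `B`. -/
def Emb (A B : Set (List ℕ)) : Prop := ∃ P, P [] [] ∧ Simulates A B P

/-- A certificate that `A` cannot be simulated in `B`. -/
def Refutes (A B : Set (List ℕ)) (V : List ℕ → List ℕ → Prop) : Prop :=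
  ∀ a b, V a b → a ∈ A ∧ (b ∈ B → ∃ n, ∀ m, V (a ++ [n]) (b ++ [m]))

variable {A B : Set (List ℕ)}

theorem IllFounded.of_emb (hA : IllFounded A) (h : Emb A B) : IllFounded B := by
  obtain ⟨f, hf⟩ := hA
  obtain ⟨P, h0, hP⟩ := h
  refine illFounded_of_forall_exists (Q := fun b => P ((List.range b.length).map f) b)
    (by simpa using h0) fun b hb => ?_
  obtain ⟨h1, h2⟩ := hP _ _ hb (hf _)
  refine ⟨h1, (h2 (f b.length)).imp fun m hm => ?_⟩
  simpa [List.range_succ] using hm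

theorem IllFounded.emb (hB : IllFounded B) : Emb A B := by
  obtain ⟨g, hg⟩ := hB
  refine ⟨fun a b => b = (List.range a.length).map g, rfl, ?_⟩
  rintro a b rfl -
  exact ⟨hg _, fun n => ⟨g a.length, by simp [List.range_succ]⟩⟩

theorem not_emb_iff (hA : ¬ IllFounded A) : ¬ Emb A B ↔ ∃ V, V [] [] ∧ Refutes A B V := by
  constructor
  · intro h
    refine ⟨fun a b => ¬ ∃ P : List ℕ → List ℕ → Prop, P a b ∧ Simulates A B P, h,
      fun a b hab => ?_⟩
    by_contra hc
    have hc : a ∈ A → b ∈ B ∧ ∀ n, ∃ m, ∃ P : List ℕ → List ℕ → Prop,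
        P (a ++ [n]) (b ++ [m]) ∧ Simulates A B P := by
      intro ha
      by_contra h'
      exact hc ⟨ha, fun hb => by simpa [hb] using h'⟩
    refine hab ⟨fun a' b' => (a' = a ∧ b' = b) ∨
      ∃ P : List ℕ → List ℕ → Prop, P a' b' ∧ Simulates A B P,
      Or.inl ⟨rfl, rfl⟩, ?_⟩
    rintro a' b' (⟨rfl, rfl⟩ | ⟨P, hP, hS⟩) ha
    · exact ⟨(hc ha).1, fun n => ((hc ha).2 n).imp fun m hm => Or.inr hm⟩
    · exact ⟨(hS _ _ hP ha).1, fun n => ((hS _ _ hP ha).2 n).imp fun m hm =>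
        Or.inr ⟨P, hm, hS⟩⟩
  · rintro ⟨V, V0, hV⟩ ⟨P, P0, hP⟩
    refine hA (illFounded_of_forall_exists (Q := fun a => ∃ b, P a b ∧ V a b)
      ⟨[], P0, V0⟩ ?_)
    rintro a ⟨b, hp, hv⟩
    obtain ⟨ha, hv⟩ := hV _ _ hv
    obtain ⟨hb, hp⟩ := hP _ _ hp ha
    obtain ⟨n, hn⟩ := hv hb
    obtain ⟨m, hm⟩ := hp n
    exact ⟨ha, n, b ++ [m], hm, hn m⟩

/-- Quantification over binary relations on `List ℕ`, coded as reals. -/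
theorem exists_rel_iff {Q : (List ℕ → List ℕ → Prop) → Prop} :
    (∃ P, Q P) ↔ ∃ f : ℕ → ℕ, Q fun a b => f (Nat.pair (Encodable.encode a)
      (Encodable.encode b)) = 1 := by
  classical
  refine ⟨fun ⟨P, hP⟩ => ⟨fun n => if P (Denumerable.ofNat _ n.unpair.1)
    (Denumerable.ofNat _ n.unpair.2) then 1 else 0, ?_⟩, fun ⟨f, hf⟩ => ⟨_, hf⟩⟩
  simpa using hP

/-- The binary relation on `List ℕ` coded by a real. -/
def CodedRel (ρ : ℕ → ℕ × γ) (a b : List ℕ) : Prop :=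
  (ρ (Nat.pair (Encodable.encode a) (Encodable.encode b))).1 = 1

theorem NF.codedRel [DecidableEq γ] {u v : α → List ℕ} (hu : Computable u) (hv : Computable v) :
    NF fun a (ρ : ℕ → ℕ × γ) => CodedRel ρ (u a) (v a) :=
  Del.atReal (P := fun (_ : α) (y : ℕ × γ) => y.1 = 1) (Del.eq (by fun_prop) (by fun_prop))
    (by fun_prop)

theorem NF.not_codedRel [DecidableEq γ] {u v : α → List ℕ} (hu : Computable u)
    (hv : Computable v) : NF fun a (ρ : ℕ → ℕ × γ) => ¬ CodedRel ρ (u a) (v a) :=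
  Del.atReal (P := fun (_ : α) (y : ℕ × γ) => ¬ y.1 = 1)
    (Del.eq (by fun_prop) (by fun_prop)).not (by fun_prop)

theorem NF.emb {A B : α → Set (List ℕ)} (hA : Del fun x : α × List ℕ => x.2 ∈ A x.1)
    (hB : Del fun x : α × List ℕ => x.2 ∈ B x.1) : NF (γ := γ) fun a _ => Emb (A a) (B a) := by
  refine NF.lift (NF.congr ?_ fun a _ => exists_rel_iff.symm)
  refine NF.exReal (P := fun a ρ => CodedRel ρ [] [] ∧
    Simulates (A a) (B a) (CodedRel ρ)) ?_
  refine (NF.codedRel (by fun_prop) (by fun_prop)).and ?_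
  simp only [Simulates, imp_iff_not_or]
  refine NF.forall ?_
  refine NF.forall ?_
  refine NF.or (NF.not_codedRel ?_ ?_) (NF.or
    (Del.nfnot (hA.subst (u := fun x : (α × List ℕ) × List ℕ => (x.1.1, x.1.2)) ?_))
    (NF.and (Del.nf (hB.subst (u := fun x : (α × List ℕ) × List ℕ => (x.1.1, x.2)) ?_)) ?_))
  rotate_right
  · refine NF.forall ?_
    refine NF.exists ?_
    exact NF.codedRel (by fun_prop) (by fun_prop)
  all_goals fun_prop

theorem NF.not_emb {A B : α → Set (List ℕ)} (hA : Del fun x : α × List ℕ => x.2 ∈ A x.1)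
    (hB : Del fun x : α × List ℕ => x.2 ∈ B x.1) (hwf : ∀ a, ¬ IllFounded (A a)) :
    NF (γ := γ) fun a _ => ¬ Emb (A a) (B a) := by
  refine NF.lift (NF.congr ?_ fun a _ => ((not_emb_iff (hwf a)).trans exists_rel_iff).symm)
  refine NF.exReal (P := fun a ρ => CodedRel ρ [] [] ∧
    Refutes (A a) (B a) (CodedRel ρ)) ?_
  refine (NF.codedRel (by fun_prop) (by fun_prop)).and ?_
  simp only [Refutes, imp_iff_not_or]
  refine NF.forall ?_
  refine NF.forall ?_
  refine NF.or (NF.not_codedRel ?_ ?_) (NF.and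
    (Del.nf (hA.subst (u := fun x : (α × List ℕ) × List ℕ => (x.1.1, x.1.2)) ?_))
    (NF.or (Del.nfnot (hB.subst (u := fun x : (α × List ℕ) × List ℕ => (x.1.1, x.2)) ?_)) ?_))
  rotate_right
  · refine NF.exists ?_
    refine NF.forall ?_
    exact NF.codedRel (by fun_prop) (by fun_prop)
  all_goals fun_prop

theorem NF.isPath {e : α → ℕ} (he : Computable e) :
    NF fun a (ρ : ℕ → ℕ × γ) => IsPath (treeAt (e a)) fun n => (ρ n).1 := by
  classical
  have key : NF fun a (ρ : ℕ → ℕ) => IsPath (treeAt (e a)) ρ := by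
    have h : NF fun a (ρ : ℕ → ℕ) => ∀ l : List ℕ,
        (∃ i v, l[i]? = some v ∧ ¬ ρ i = v) ∨ l ∈ treeAt (e a) := by
      refine NF.forall ?_
      refine NF.or ?_ (Del.nf (Del.mem_treeAt (by fun_prop) (by fun_prop)))
      refine NF.exists ?_
      refine NF.exists ?_
      refine NF.and (Del.nf (Del.eq (by fun_prop) (by fun_prop))) ?_
      exact Del.atReal (P := fun (x : ((α × List ℕ) × ℕ) × ℕ) (y : ℕ) => ¬ y = x.2)
        (Del.not (Del.eq (by fun_prop) (by fun_prop))) (by fun_prop)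
    refine h.congr fun a ρ => ⟨fun h k => ?_, fun h l => ?_⟩
    · refine (h ((List.range k).map ρ)).resolve_left ?_
      rintro ⟨i, v, h1, h2⟩
      simp only [List.getElem?_map, Option.map_eq_some_iff] at h1
      obtain ⟨j, hj, rfl⟩ := h1
      obtain ⟨_, rfl⟩ := List.getElem?_eq_some_iff.1 hj
      simp at h2
    · by_cases hl : l = (List.range l.length).map ρ
      · right; rw [hl]; exact h _
      · left
        by_contra! hc
        refine hl (List.ext_getElem (by simp) fun i h1 h2 => ?_)
        simp [hc i l[i] (by simp)]
  exact key.rsubst (g := fun x : ℕ × γ => x.1) Primrec.fst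

/-- `f` is bounded by `s`, as far as `s` is defined. -/
def BoundedBy (f : ℕ → ℕ) (s : List ℕ) : Prop := ∀ n v, s[n]? = some v → f n ≤ v

/-- The tree with index `e` has a path bounded by `s`. -/
def HasPathBelow (e : ℕ) (s : List ℕ) : Prop :=
  ∃ f, IsPath (treeAt e) f ∧ BoundedBy f s

/-- The subtree of the tree with index `e` of nodes bounded by `s`. -/
def treeBelow (e : ℕ) (s : List ℕ) : Set (List ℕ) :=
  {ν : List ℕ | ν ∈ treeAt e ∧ ∀ n v w : ℕ, ν[n]? = some v → s[n]? = some w → v ≤ w}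

theorem illFounded_treeBelow {e : ℕ} {s : List ℕ} :
    IllFounded (treeBelow e s) ↔ HasPathBelow e s := by
  refine exists_congr fun f => ⟨fun h => ⟨fun k => (h k).1, fun n v hv => ?_⟩,
    fun h k => ⟨h.1 k, fun n v w hv hw => ?_⟩⟩
  · exact (h (n + 1)).2 n (f n) v (by simp) hv
  · simp only [List.getElem?_map, Option.map_eq_some_iff] at hv
    obtain ⟨i, hi, rfl⟩ := hv
    obtain ⟨hi, rfl⟩ := List.getElem?_eq_some_iff.1 hi
    simpa using h.2 n w hw

theorem IllFounded.hasPathBelow_nil {e : ℕ} (h : IllFounded (treeAt e)) : HasPathBelow e [] :=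
  h.imp fun _ hf => ⟨hf, by simp [BoundedBy]⟩

theorem Del.mem_treeBelow {e : α → ℕ} {s ν : α → List ℕ} (he : Computable e) (hs : Computable s)
    (hν : Computable ν) : Del fun a => ν a ∈ treeBelow (e a) (s a) := by
  refine (Del.mem_treeAt he hν).and (Del.forall ?_)
  refine Del.forall (P := fun (x : α × ℕ) (v : ℕ) => ∀ w, (ν x.1)[x.2]? = some v →
    (s x.1)[x.2]? = some w → v ≤ w) (Del.forall ?_)
  refine Del.imp (Del.eq ?_ ?_) (Del.imp (Del.eq ?_ ?_) (Del.le ?_ ?_))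
  all_goals fun_prop

end Trees

/-- A log `σ` of instructions `(e, v)`, "append `v` to column `e`", read off at column `e`. -/
def col (σ : List (ℕ × ℕ)) (e : ℕ) : List ℕ :=
  σ.filterMap fun x => if x.1 = e then some x.2 else none

theorem col_append (σ τ : List (ℕ × ℕ)) (e : ℕ) : col (σ ++ τ) e = col σ e ++ col τ e := by
  simp [col]

theorem col_isPrefix {σ σ' : List (ℕ × ℕ)} (h : σ <+: σ') (e : ℕ) : col σ e <+: col σ' e := by
  obtain ⟨τ, rfl⟩ := h
  exact ⟨col τ e, (col_append _ _ _).symm⟩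

theorem mem_of_col_ne_nil {σ : List (ℕ × ℕ)} {e : ℕ} (h : col σ e ≠ []) :
    e ∈ σ.map Prod.fst := by
  obtain ⟨v, hv⟩ := List.exists_mem_of_ne_nil _ h
  simp only [col, List.mem_filterMap] at hv
  obtain ⟨x, hx, h⟩ := hv
  split_ifs at h with he
  exact List.mem_map.2 ⟨x, hx, he⟩

theorem getElem?_of_isPrefix {α : Type} {s t : List α} (h : s <+: t) {n : ℕ} {v : α}
    (hv : s[n]? = some v) : t[n]? = some v := by
  obtain ⟨u, rfl⟩ := h
  rw [List.getElem?_append_left (List.getElem?_eq_some_iff.1 hv).1, hv]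

/-- Every entry of the log bounds the corresponding value of `h`. -/
def Above (h : ℕ → ℕ) (σ : List (ℕ × ℕ)) : Prop :=
  ∀ e n v, (col σ e)[n]? = some v → h (Nat.pair e n) ≤ v

/-- `h` extends the log. -/
def Agree (h : ℕ → ℕ) (σ : List (ℕ × ℕ)) : Prop :=
  ∀ e n v, (col σ e)[n]? = some v → h (Nat.pair e n) = v

/-- Column `e` of `h` bounds a path through the tree with index `e`. -/
def Dominated (e : ℕ) (h : ℕ → ℕ) : Prop :=
  ∃ f, IsPath (treeAt e) f ∧ ∀ n, f n ≤ h (Nat.pair e n)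

theorem Agree.above {h : ℕ → ℕ} {σ : List (ℕ × ℕ)} (H : Agree h σ) : Above h σ :=
  fun e n v hv => (H e n v hv).le

theorem Agree.of_isPrefix {h : ℕ → ℕ} {σ σ' : List (ℕ × ℕ)} (H : Agree h σ') (hp : σ <+: σ') :
    Agree h σ := fun e n v hv => H e n v (getElem?_of_isPrefix (col_isPrefix hp e) hv)

theorem Above.mono {h h' : ℕ → ℕ} {σ : List (ℕ × ℕ)} (H : Above h' σ) (hle : h ≤ h') :
    Above h σ := fun e n v hv => (hle _).trans (H e n v hv)

theorem Dominated.mono {h h' : ℕ → ℕ} {e : ℕ} (H : Dominated e h) (hle : h ≤ h') :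
    Dominated e h' := H.imp fun _ hf => ⟨hf.1, fun n => (hf.2 n).trans (hle _)⟩

theorem Dominated.hasPathBelow {h : ℕ → ℕ} {e : ℕ} (H : Dominated e h) {σ : List (ℕ × ℕ)}
    (hσ : Above h σ) : HasPathBelow e (col σ e) :=
  H.imp fun _ hf => ⟨hf.1, fun n v hv => (hf.2 n).trans (hσ e n v hv)⟩

theorem HasPathBelow.of_isPrefix {e : ℕ} {s t : List ℕ} (h : HasPathBelow e t) (hp : s <+: t) :
    HasPathBelow e s :=
  h.imp fun _ hf => ⟨hf.1, fun n v hv => hf.2 n v (getElem?_of_isPrefix hp hv)⟩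

section

variable {α : Type} [Primcodable α]

@[fun_prop]
theorem computable_col {σ : α → List (ℕ × ℕ)} {e : α → ℕ} (hσ : Computable σ)
    (he : Computable e) : Computable fun a => col (σ a) (e a) := by
  have h : Primrec fun x : List (ℕ × ℕ) × ℕ => col x.1 x.2 := by
    refine Primrec.listFilterMap Primrec.fst (Primrec.ite (Primrec.eq.comp
      (Primrec.fst.comp Primrec.snd) (Primrec.snd.comp Primrec.fst)) ?_ (Primrec.const none))
    exact Primrec.option_some.comp (Primrec.snd.comp Primrec.snd)
  exact h.to_comp.comp (g := fun a => (σ a, e a)) (by fun_prop)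

theorem NF.forall_col {σ : α → List (ℕ × ℕ)} (hσ : Computable σ) {R : ℕ → ℕ → Prop}
    (hR : Del fun x : ℕ × ℕ => R x.1 x.2) :
    NF fun a (h : ℕ → ℕ) => ∀ e n v, (col (σ a) e)[n]? = some v → R (h (Nat.pair e n)) v := by
  simp only [imp_iff_not_or]
  refine NF.forall ?_
  refine NF.forall ?_
  refine NF.forall ?_
  refine NF.or (Del.nfnot (Del.eq (by fun_prop) (by fun_prop))) ?_
  exact Del.atReal (P := fun (x : ((α × ℕ) × ℕ) × ℕ) (y : ℕ) => R y x.2)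
    (hR.subst (u := fun x : (((α × ℕ) × ℕ) × ℕ) × ℕ => (x.2, x.1.2)) (by fun_prop)) (by fun_prop)

theorem NF.above {σ : α → List (ℕ × ℕ)} (hσ : Computable σ) :
    NF fun a (h : ℕ → ℕ) => Above h (σ a) :=
  NF.forall_col hσ (Del.le (by fun_prop) (by fun_prop))

theorem NF.agree {σ : α → List (ℕ × ℕ)} (hσ : Computable σ) :
    NF fun a (h : ℕ → ℕ) => Agree h (σ a) :=
  NF.forall_col hσ (Del.eq (by fun_prop) (by fun_prop))

theorem NF.not_above {σ : α → List (ℕ × ℕ)} (hσ : Computable σ) :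
    NF fun a (h : ℕ → ℕ) => ¬ Above h (σ a) := by
  have : NF fun a (h : ℕ → ℕ) => ∃ e n v, (col (σ a) e)[n]? = some v ∧
      ¬ h (Nat.pair e n) ≤ v := by
    refine NF.exists ?_
    refine NF.exists ?_
    refine NF.exists ?_
    refine NF.and (Del.nf (Del.eq (by fun_prop) (by fun_prop))) ?_
    exact Del.atReal (P := fun (x : ((α × ℕ) × ℕ) × ℕ) (y : ℕ) => ¬ y ≤ x.2)
      (Del.not (Del.le (by fun_prop) (by fun_prop))) (by fun_prop)
  exact this.congr fun a h => by simp [Above]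

theorem NF.dominated {e : α → ℕ} (he : Computable e) :
    NF fun a (h : ℕ → ℕ) => Dominated (e a) h := by
  refine NF.exReal (P := fun a ρ => IsPath (treeAt (e a)) (fun n => (ρ n).1) ∧
    ∀ n, (ρ n).1 ≤ (ρ (Nat.pair (e a) n)).2) ((NF.isPath he).and ?_)
  refine NF.forall ?_
  refine NF.read (P := fun (x : (α × ℕ) × (ℕ × ℕ)) (ρ : ℕ → ℕ × ℕ) =>
    x.2.1 ≤ (ρ (Nat.pair (e x.1.1) x.1.2)).2) ?_ (u := fun x => x.2) (by fun_prop)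
  exact Del.atReal (P := fun (x : (α × ℕ) × (ℕ × ℕ)) (y : ℕ × ℕ) => x.2.1 ≤ y.2)
    (Del.le (by fun_prop) (by fun_prop)) (by fun_prop)

end

/-- Forcing conditions: a finite log `σ`, a finite set `E` of active columns, a `Σ¹₁` class `S`
of bounding functions, and a `Π¹₁` restriction `B` on future new columns. -/
structure Cond where
  σ : List (ℕ × ℕ)
  E : Finset ℕ
  S : (ℕ → ℕ) → Prop
  B : ℕ → List ℕ → Prop
  touched : ∀ e, col σ e ≠ [] → e ∈ E
  agree : ∀ h, S h → Agree h σ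
  dominated : ∀ h, S h → ∀ e ∈ E, IllFounded (treeAt e) → Dominated e h
  up : ∀ h h', S h → h ≤ h' → Agree h' σ → S h'
  nonempty : ∃ h, S h
  nf_S : NF fun (_ : Unit) h => S h
  of_hasPathBelow : ∀ e s, HasPathBelow e s → B e s
  nf_B : NF (γ := Unit) fun (x : ℕ × List ℕ) _ => ¬ B x.1 x.2

namespace Cond

/-- `σ₁` is an admissible extension of the log of `p`, as far as `h` is concerned. -/
def Admits (p : Cond) (h : ℕ → ℕ) (σ₁ : List (ℕ × ℕ)) : Prop :=
  p.σ <+: σ₁ ∧ Above h σ₁ ∧ (∀ e ∈ p.E, ¬ IllFounded (treeAt e) → col σ₁ e = col p.σ e) ∧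
    ∀ e ∉ p.E, col σ₁ e ≠ [] → p.B e (col σ₁ e)

/-- `q` refines `p`. -/
structure Le (p q : Cond) : Prop where
  log : p.σ <+: q.σ
  active : p.E ⊆ q.E
  S : ∀ h, q.S h → p.S h
  B : ∀ e s, q.B e s → p.B e s
  frozen : ∀ e ∈ p.E, ¬ IllFounded (treeAt e) → col q.σ e = col p.σ e
  new : ∀ e ∈ q.E, e ∉ p.E → col q.σ e ≠ [] → p.B e (col q.σ e)

theorem hasPathBelow {p : Cond} {e : ℕ} (he : e ∈ p.E) (h : IllFounded (treeAt e)) :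
    HasPathBelow e (col p.σ e) := by
  obtain ⟨f, hf⟩ := p.nonempty
  exact (p.dominated f hf e he h).hasPathBelow (p.agree f hf).above

theorem col_eq_nil {p : Cond} {e : ℕ} (he : e ∉ p.E) : col p.σ e = [] := by
  by_contra h
  exact he (p.touched e h)

instance : Preorder Cond where
  le := Le
  le_refl p := ⟨List.prefix_rfl, subset_rfl, fun _ h => h, fun _ _ h => h, fun _ _ _ => rfl,
    fun _ h h' => absurd h h'⟩
  le_trans p q r h h' := by
    refine ⟨h.log.trans h'.log, h.active.trans h'.active, fun f hf => h.S f (h'.S f hf),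
      fun e s hs => h.B e s (h'.B e s hs), fun e he hw => ?_, fun e he hn hc => ?_⟩
    · rw [h'.frozen e (h.active he) hw, h.frozen e he hw]
    · by_cases hw : IllFounded (treeAt e)
      · exact p.of_hasPathBelow _ _ (r.hasPathBelow he hw)
      by_cases hq : e ∈ q.E
      · rw [h'.frozen e hq hw] at hc ⊢
        exact h.new e hq hn hc
      · exact h.B _ _ (h'.new e he hq hc)

theorem admits_of_le {p q : Cond} (hpq : p ≤ q) {h : ℕ → ℕ} (hh : q.S h) : p.Admits h q.σ :=
  ⟨hpq.log, (q.agree h hh).above, hpq.frozen, fun e he hc => hpq.new e (q.touched e hc) he hc⟩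

theorem hasPathBelow_col {p : Cond} {e : ℕ} (h : IllFounded (treeAt e)) :
    HasPathBelow e (col p.σ e) := by
  by_cases he : e ∈ p.E
  · exact hasPathBelow he h
  · rw [col_eq_nil he]; exact h.hasPathBelow_nil

theorem exists_le {p : Cond} {h : ℕ → ℕ} {σ' : List (ℕ × ℕ)} (hh : p.S h)
    (hσ : p.Admits h σ')
    (hσ' : ∀ e ∉ p.E, IllFounded (treeAt e) → HasPathBelow e (col σ' e)) :
    ∃ q, p ≤ q ∧ q.σ = σ' := by
  classical
  choose! F hF hFb using hσ'
  let E' : Finset ℕ := p.E ∪ (σ'.map Prod.fst).toFinset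
  let A : Set ℕ := {e | e ∈ E' ∧ e ∉ p.E ∧ IllFounded (treeAt e)}
  have hA : A.Finite := E'.finite_toSet.subset fun e he => he.1
  let g : ℕ → ℕ := fun m => ((col σ' m.unpair.1)[m.unpair.2]?).getD
    (max (h m) (F m.unpair.1 m.unpair.2))
  have g_agree : Agree g σ' := fun e n v hv => by simp [g, hv]
  have g_le : h ≤ g := fun m => by
    simp only [g]
    cases hv : (col σ' m.unpair.1)[m.unpair.2]? with
    | none => simp
    | some v => simpa using hσ.2.1 _ _ _ hv
  have g_dom : ∀ e ∉ p.E, IllFounded (treeAt e) → Dominated e g := fun e he hi =>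
    ⟨F e, hF e he hi, fun n => by
      simp only [g, Nat.unpair_pair]
      cases hv : (col σ' e)[n]? with
      | none => simp
      | some v => simpa using hFb e he hi _ _ hv⟩
  refine ⟨{
    σ := σ', E := E',
    S := fun h' => p.S h' ∧ Agree h' σ' ∧ ∀ e, e ∉ A ∨ Dominated e h'
    B := p.B
    touched := fun e he => Finset.mem_union_right _ (List.mem_toFinset.2 (mem_of_col_ne_nil he))
    agree := fun h' hh' => hh'.2.1
    dominated := fun h' hh' e he hi => ?_
    up := fun h₁ h₂ H hle ha => ⟨p.up h₁ h₂ H.1 hle (ha.of_isPrefix hσ.1), ha,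
      fun e => (H.2.2 e).imp_right fun H => H.mono hle⟩
    nonempty := ⟨g, p.up h g hh g_le (g_agree.of_isPrefix hσ.1), g_agree, fun e => ?_⟩
    nf_S := ?_
    of_hasPathBelow := p.of_hasPathBelow
    nf_B := p.nf_B }, ⟨hσ.1, Finset.subset_union_left, fun h' hh' => hh'.1, fun _ _ H => H,
      hσ.2.2.1, fun e _ he hc => hσ.2.2.2 e he hc⟩, rfl⟩
  · by_cases hp : e ∈ p.E
    · exact p.dominated h' hh'.1 e hp hi
    · exact (hh'.2.2 e).resolve_left fun hn => hn ⟨he, hp, hi⟩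
  · by_cases he : e ∈ A
    · exact Or.inr (g_dom e he.2.1 he.2.2)
    · exact Or.inl he
  · refine p.nf_S.and ((NF.agree (by fun_prop)).and (NF.forall ?_))
    exact NF.or (Del.nfnot ((Del.finite hA).subst (u := fun x : Unit × ℕ => x.2) (by fun_prop)))
      (NF.dominated (by fun_prop))

theorem exists_dominating (p : Cond) : ∃ h, p.S h ∧ ∀ e, IllFounded (treeAt e) → Dominated e h := by
  classical
  obtain ⟨h, hh⟩ := p.nonempty
  choose! F hF using fun (e : ℕ) (he : IllFounded (treeAt e)) => he
  let g : ℕ → ℕ := fun m => if m.unpair.1 ∈ p.E then h m else max (h m) (F m.unpair.1 m.unpair.2)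
  have g_le : h ≤ g := fun m => by simp only [g]; split_ifs <;> simp
  have hg : p.S g := by
    refine p.up h g hh g_le fun e n v hv => ?_
    have he : e ∈ p.E := p.touched e fun hc => by simp [hc] at hv
    simpa [g, he] using p.agree h hh e n v hv
  refine ⟨g, hg, fun e hi => ?_⟩
  by_cases he : e ∈ p.E
  · exact p.dominated g hg e he hi
  · exact ⟨F e, hF e hi, fun n => by simp [g, he]⟩

theorem exists_le_of_dominating {p : Cond} {h : ℕ → ℕ} {σ' : List (ℕ × ℕ)} (hh : p.S h)
    (hd : ∀ e, IllFounded (treeAt e) → Dominated e h) (hσ : p.Admits h σ') :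
    ∃ q, p ≤ q ∧ q.σ = σ' :=
  exists_le hh hσ fun e _ hi => (hd e hi).hasPathBelow hσ.2.1

theorem exists_le_length (p : Cond) {e : ℕ} (hi : IllFounded (treeAt e)) (L : ℕ) :
    ∃ q, p ≤ q ∧ L ≤ (col q.σ e).length := by
  induction L with
  | zero => exact ⟨p, le_rfl, Nat.zero_le _⟩
  | succ L ih =>
    obtain ⟨q, hpq, hq⟩ := ih
    obtain ⟨h, hh, hd⟩ := q.exists_dominating
    have hcol : ∀ e', e' ≠ e → col (q.σ ++ [(e, h (Nat.pair e (col q.σ e).length))]) e' =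
        col q.σ e' := fun e' he => by simp [col, he.symm]
    have hcol' : col (q.σ ++ [(e, h (Nat.pair e (col q.σ e).length))]) e =
        col q.σ e ++ [h (Nat.pair e (col q.σ e).length)] := by simp [col]
    have hab : Above h (q.σ ++ [(e, h (Nat.pair e (col q.σ e).length))]) := by
      intro e' n v hv
      by_cases he : e' = e
      · subst he
        rw [hcol', List.getElem?_append] at hv
        split_ifs at hv with hn
        · exact (q.agree h hh).above _ _ _ hv
        · obtain ⟨h1, h2⟩ := List.getElem?_eq_some_iff.1 hv
          simp only [List.length_singleton] at h1
          have : n = (col q.σ e').length := by omega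
          simp only [List.getElem_singleton] at h2
          rw [this, h2]
      · rw [hcol e' he] at hv
        exact (q.agree h hh).above _ _ _ hv
    obtain ⟨r, hqr, hr⟩ := exists_le_of_dominating (p := q) hh hd
      (σ' := q.σ ++ [(e, h (Nat.pair e (col q.σ e).length))])
      ⟨List.prefix_append _ _, hab, fun e' _ hw => hcol e' fun h => hw (h ▸ hi), fun e' he' hc => by
        by_cases he : e' = e
        · subst he
          exact q.of_hasPathBelow _ _ ((hd e' hi).hasPathBelow hab)
        · rw [hcol e' he] at hc
          exact absurd (q.touched e' hc) he'⟩
    refine ⟨r, hpq.trans hqr, ?_⟩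
    rw [hr, hcol', List.length_append, List.length_singleton]
    omega

/-- The weakest condition. -/
def trivial : Cond where
  σ := []
  E := ∅
  S := fun _ => True
  B := fun _ _ => True
  touched := fun e h => absurd rfl h
  agree := fun h _ e n v hv => by simp [col] at hv
  dominated := by simp
  up := by simp
  nonempty := ⟨fun _ => 0, True.intro⟩
  nf_S := (Del.const True).nf
  of_hasPathBelow := by simp
  nf_B := (Del.const (¬ True)).nf

theorem nf_B' (p : Cond) {α γ : Type} [Primcodable α] [Primcodable γ] {e : α → ℕ}
    {s : α → List ℕ} (he : Computable e) (hs : Computable s) :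
    NF (γ := γ) fun a _ => ¬ p.B (e a) (s a) :=
  NF.lift (p.nf_B.subst (u := fun a => (e a, s a)) (by fun_prop))

theorem nf_not_admits (p : Cond) {α : Type} [Primcodable α] {σ' : α → List (ℕ × ℕ)}
    (hσ : Computable σ') : NF fun a h => ¬ p.Admits h (σ' a) := by
  have hA : Set.Finite {e | e ∈ p.E ∧ ¬ IllFounded (treeAt e)} :=
    p.E.finite_toSet.subset fun e he => he.1
  have : NF fun a (h : ℕ → ℕ) => ¬ p.σ <+: σ' a ∨ ¬ Above h (σ' a) ∨
      (∃ e, e ∈ {e | e ∈ p.E ∧ ¬ IllFounded (treeAt e)} ∧ ¬ col (σ' a) e = col p.σ e) ∨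
      ∃ e, ¬ e ∈ (p.E : Set ℕ) ∧ ¬ col (σ' a) e = [] ∧ ¬ p.B e (col (σ' a) e) := by
    refine NF.or (Del.isPrefix (by fun_prop) (by fun_prop)).nfnot
      (NF.or (NF.not_above (by fun_prop)) (NF.or ?_ ?_))
    · refine NF.exists ?_
      exact NF.and ((Del.finite hA).subst (u := fun x : α × ℕ => x.2) (by fun_prop)).nf
        (Del.eq (by fun_prop) (by fun_prop)).nfnot
    · refine NF.exists ?_
      exact NF.and ((Del.finite p.E.finite_toSet).subst (u := fun x : α × ℕ => x.2)
        (by fun_prop)).nfnot (NF.and (Del.eq (by fun_prop) (by fun_prop)).nfnot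
          (p.nf_B' (by fun_prop) (by fun_prop)))
  refine this.congr fun a h => ?_
  simp only [Admits, not_and_or, not_forall, Set.mem_ofPred_eq, SetLike.mem_coe]
  simp only [exists_prop, and_assoc, ne_eq]

variable {V : List (ℕ × ℕ) → ℕ → Prop}

theorem exists_le_ne_illFounded (p : Cond) (hV : Del fun x : List (ℕ × ℕ) × ℕ => V x.1 x.2) :
    ∃ q, p ≤ q ∧ ((∃ e, IllFounded (treeAt e) ∧ ∀ r, q ≤ r → ¬ V r.σ e) ∨
      ∃ e, ¬ IllFounded (treeAt e) ∧ V q.σ e) := by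
  have hVn {α : Type} [Primcodable α] {σ : α → List (ℕ × ℕ)} {e : α → ℕ} (hσ : Computable σ)
      (he : Computable e) : NF (γ := ℕ) fun a _ => ¬ V (σ a) (e a) :=
    (hV.subst (u := fun a => (σ a, e a)) (by fun_prop)).nfnot
  have key : NF fun e (h : ℕ → ℕ) => p.S h ∧ ∀ σ', ¬ p.Admits h σ' ∨ ¬ V σ' e := by
    refine (p.nf_S.subst (u := fun _ => ()) (by fun_prop)).and ?_
    refine NF.forall ?_
    exact NF.or (p.nf_not_admits (by fun_prop)) (hVn (by fun_prop) (by fun_prop))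
  have hR : NF (γ := Unit) fun e _ => ∃ h, p.S h ∧ ∀ σ', ¬ p.Admits h σ' ∨ ¬ V σ' e :=
    NF.exReal (P := fun e ρ => p.S (fun n => (ρ n).1) ∧
      ∀ σ', ¬ p.Admits (fun n => (ρ n).1) σ' ∨ ¬ V σ' e)
      (key.rsubst (g := fun x : ℕ × Unit => x.1) Primrec.fst)
  obtain ⟨e, he⟩ : ∃ e, ¬ ((∃ h, p.S h ∧ ∀ σ', ¬ p.Admits h σ' ∨ ¬ V σ' e) ↔
      ¬ IllFounded (treeAt e)) := by
    by_contra! hc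
    exact not_nf_wf (hR.congr fun e _ => hc e)
  by_cases hi : IllFounded (treeAt e)
  · obtain ⟨h₀, hh₀⟩ : ∃ h, p.S h ∧ ∀ σ', ¬ p.Admits h σ' ∨ ¬ V σ' e := by tauto
    let q : Cond :=
      { p with
        S := fun h => p.S h ∧ ∀ σ', ¬ p.Admits h σ' ∨ ¬ V σ' e
        agree := fun h hh => p.agree h hh.1
        dominated := fun h hh => p.dominated h hh.1
        up := fun h h' hh hle ha => ⟨p.up h h' hh.1 hle ha, fun σ' =>
          (hh.2 σ').imp_left fun hn hs => hn ⟨hs.1, hs.2.1.mono hle, hs.2.2⟩⟩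
        nonempty := ⟨h₀, hh₀⟩
        nf_S := key.subst (u := fun _ => e) (by fun_prop) }
    have hpq : p ≤ q := ⟨List.prefix_rfl, subset_rfl, fun _ h => h.1, fun _ _ h => h,
      fun _ _ _ => rfl, fun _ h h' => absurd h h'⟩
    refine ⟨q, hpq, Or.inl ⟨e, hi, fun r hr => ?_⟩⟩
    obtain ⟨h, hh⟩ := r.nonempty
    exact ((hr.S h hh).2 r.σ).resolve_left
      (not_not.2 (admits_of_le (hpq.trans hr) hh))
  · obtain ⟨h, hh, hd⟩ := p.exists_dominating
    have : ∃ σ', p.Admits h σ' ∧ V σ' e := by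
      by_contra! hc
      exact he ⟨fun _ => hi, fun _ => ⟨h, hh, fun σ' => not_or_of_imp (hc σ')⟩⟩
    obtain ⟨σ', hσ', hv⟩ := this
    obtain ⟨q, hpq, rfl⟩ := exists_le_of_dominating hh hd hσ'
    exact ⟨q, hpq, Or.inr ⟨e, hi, hv⟩⟩

theorem exists_le_ne_wf (p : Cond) (hV : Del fun x : List (ℕ × ℕ) × ℕ => V x.1 x.2) :
    ∃ q, p ≤ q ∧ ((∃ e, ¬ IllFounded (treeAt e) ∧ ∀ r, q ≤ r → ¬ V r.σ e) ∨
      ∃ e, IllFounded (treeAt e) ∧ V q.σ e) := by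
  let R₀ : ℕ → (ℕ → ℕ) → List (ℕ × ℕ) → Prop := fun e h σ' => p.σ <+: σ' ∧ Above h σ' ∧
    (∀ e', ¬ e' ∈ {e | e ∈ p.E ∧ ¬ IllFounded (treeAt e)} ∨ col σ' e' = col p.σ e') ∧ V σ' e ∧
      ∀ e', e' ∈ (p.E : Set ℕ) ∨ col σ' e' = [] ∨ Emb (treeAt e) (treeBelow e' (col σ' e'))
  have hA : Set.Finite {e | e ∈ p.E ∧ ¬ IllFounded (treeAt e)} :=
    p.E.finite_toSet.subset fun e he => he.1
  have key : NF fun e (h : ℕ → ℕ) => p.S h ∧ ∃ σ', R₀ e h σ' := by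
    refine (p.nf_S.subst (u := fun _ => ()) (by fun_prop)).and ?_
    refine NF.exists ?_
    refine (Del.isPrefix (by fun_prop) (by fun_prop)).nf.and ((NF.above (by fun_prop)).and
      (NF.and ?_ (NF.and ?_ ?_)))
    · refine NF.forall ?_
      exact NF.or ((Del.finite hA).subst (u := fun x : (ℕ × List (ℕ × ℕ)) × ℕ => x.2)
        (by fun_prop)).nfnot (Del.eq (by fun_prop) (by fun_prop)).nf
    · exact (hV.subst (u := fun x : ℕ × List (ℕ × ℕ) => (x.2, x.1)) (by fun_prop)).nf
    · refine NF.forall ?_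
      exact NF.or ((Del.finite p.E.finite_toSet).subst
        (u := fun x : (ℕ × List (ℕ × ℕ)) × ℕ => x.2) (by fun_prop)).nf
        (NF.or (Del.eq (by fun_prop) (by fun_prop)).nf (NF.emb
          (Del.mem_treeAt (by fun_prop) (by fun_prop))
          (Del.mem_treeBelow (by fun_prop) (by fun_prop) (by fun_prop))))
  have hR : NF (γ := Unit) fun e _ => ∃ h, p.S h ∧ ∃ σ', R₀ e h σ' :=
    NF.exReal (P := fun e ρ => p.S (fun n => (ρ n).1) ∧ ∃ σ', R₀ e (fun n => (ρ n).1) σ')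
      (key.rsubst (g := fun x : ℕ × Unit => x.1) Primrec.fst)
  obtain ⟨e, he⟩ : ∃ e, ¬ ((∃ h, p.S h ∧ ∃ σ', R₀ e h σ') ↔ ¬ IllFounded (treeAt e)) := by
    by_contra! hc
    exact not_nf_wf (hR.congr fun e _ => hc e)
  by_cases hi : IllFounded (treeAt e)
  · obtain ⟨h, hh, σ', h1, h2, h3, h4, h5⟩ : ∃ h, p.S h ∧ ∃ σ', R₀ e h σ' := by
      by_contra hn
      exact he ⟨fun h => absurd h hn, fun h => absurd hi h⟩
    have hb : ∀ e' ∉ p.E, col σ' e' ≠ [] → HasPathBelow e' (col σ' e') := fun e' he' hc =>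
      illFounded_treeBelow.1 (hi.of_emb (((h5 e').resolve_left he').resolve_left hc))
    obtain ⟨q, hpq, rfl⟩ := exists_le hh (σ' := σ') ⟨h1, h2,
      fun e' he' hw => (h3 e').resolve_left fun hn => hn ⟨he', hw⟩,
      fun e' he' hc => p.of_hasPathBelow _ _ (hb e' he' hc)⟩ fun e' he' hi' => by
        by_cases hc : col σ' e' = []
        · rw [hc]; exact hi'.hasPathBelow_nil
        · exact hb e' he' hc
    exact ⟨q, hpq, Or.inr ⟨e, hi, h4⟩⟩
  · let q : Cond :=
      { p with
        B := fun e' s => p.B e' s ∧ Emb (treeAt e) (treeBelow e' s)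
        of_hasPathBelow := fun e' s hs => ⟨p.of_hasPathBelow e' s hs,
          (illFounded_treeBelow.2 hs).emb⟩
        nf_B := ((p.nf_B' (e := Prod.fst) (s := Prod.snd) Computable.fst Computable.snd).or
          (NF.not_emb (A := fun _ => treeAt e)
            (B := fun x : ℕ × List ℕ => treeBelow x.1 x.2)
            (Del.mem_treeAt (by fun_prop) (by fun_prop))
            (Del.mem_treeBelow (by fun_prop) (by fun_prop) (by fun_prop)) fun _ => hi)).congr
              fun x _ => not_and_or.symm }
    have hpq : p ≤ q := ⟨List.prefix_rfl, subset_rfl, fun _ h => h, fun _ _ h => h.1,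
      fun _ _ _ => rfl, fun _ h h' => absurd h h'⟩
    refine ⟨q, hpq, Or.inl ⟨e, hi, fun r hr hv => he ⟨fun _ => hi, fun _ => ?_⟩⟩⟩
    obtain ⟨h, hh⟩ := r.nonempty
    have hadm := admits_of_le hr (h := h) hh
    refine ⟨h, (hpq.trans hr).S h hh, r.σ, hadm.1, hadm.2.1, fun e' => ?_, hv, fun e' => ?_⟩
    · by_cases he' : e' ∈ p.E ∧ ¬ IllFounded (treeAt e')
      · exact Or.inr (hadm.2.2.1 e' he'.1 he'.2)
      · exact Or.inl he'
    · by_cases he' : e' ∈ p.E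
      · exact Or.inl he'
      by_cases hc : col r.σ e' = []
      · exact Or.inr (Or.inl hc)
      · exact Or.inr (Or.inr (hadm.2.2.2 e' he' hc).2)

end Cond

/-- `A` is one of the two sets of indices to be avoided, that of ill-founded trees and that of
well-founded trees. -/
def IsTarget (A : Set ℕ) : Prop := A = WFᶜ ∨ A = WF

theorem exists_generic_logs {ι : Type} [Encodable ι] {V : ι → List (ℕ × ℕ) → ℕ → Prop}
    (hV : ∀ i, Del fun x : List (ℕ × ℕ) × ℕ => V i x.1 x.2)
    (hmono : ∀ i σ σ' e, σ <+: σ' → V i σ e → V i σ' e) :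
    ∃ σ : ℕ → List (ℕ × ℕ), (∀ j k, j ≤ k → σ j <+: σ k) ∧
      (∀ e, IllFounded (treeAt e) → (∀ L, ∃ j, L ≤ (col (σ j) e).length) ∧
        ∀ j, HasPathBelow e (col (σ j) e)) ∧
      ∀ i A, IsTarget A → (∃ e ∉ A, ∃ j, V i (σ j) e) ∨ ∃ e ∈ A, ∀ j, ¬ V i (σ j) e := by
  let 𝒟 : (ι ⊕ ι) ⊕ (ℕ × ℕ) → Order.Cofinal Cond := fun d => match d with
    | .inl (.inl i) => ⟨{q | (∃ e, IllFounded (treeAt e) ∧ ∀ r, q ≤ r → ¬ V i r.σ e) ∨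
        ∃ e, ¬ IllFounded (treeAt e) ∧ V i q.σ e}, fun p =>
          let ⟨q, h, h'⟩ := p.exists_le_ne_illFounded (hV i); ⟨q, h', h⟩⟩
    | .inl (.inr i) => ⟨{q | (∃ e, ¬ IllFounded (treeAt e) ∧ ∀ r, q ≤ r → ¬ V i r.σ e) ∨
        ∃ e, IllFounded (treeAt e) ∧ V i q.σ e}, fun p =>
          let ⟨q, h, h'⟩ := p.exists_le_ne_wf (hV i); ⟨q, h', h⟩⟩
    | .inr (e, L) => ⟨{q | IllFounded (treeAt e) → L ≤ (col q.σ e).length}, fun p => by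
        by_cases hi : IllFounded (treeAt e)
        · obtain ⟨q, h, h'⟩ := p.exists_le_length hi L
          exact ⟨q, fun _ => h', h⟩
        · exact ⟨p, fun h => absurd h hi, le_rfl⟩⟩
  let p : ℕ → Cond := Order.sequenceOfCofinals Cond.trivial 𝒟
  have hp : Monotone p := Order.sequenceOfCofinals.monotone _ _
  have hmem (d) : ∃ j, p j ∈ 𝒟 d := ⟨_, Order.sequenceOfCofinals.encode_mem _ _ d⟩
  have decide (i) (j e) (h : ∀ r, p j ≤ r → ¬ V i r.σ e) (k : ℕ) : ¬ V i (p k).σ e := fun hk =>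
    h (p (max j k)) (hp (le_max_left _ _)) (hmono i _ _ e (hp (le_max_right j k)).log hk)
  refine ⟨fun j => (p j).σ, fun j k h => (hp h).log, fun e hi => ⟨fun L => ?_,
    fun j => Cond.hasPathBelow_col hi⟩, ?_⟩
  · obtain ⟨j, hj⟩ := hmem (.inr (e, L))
    exact ⟨j, hj hi⟩
  · rintro i A (rfl | rfl)
    · obtain ⟨j, ⟨e, hi, h⟩ | ⟨e, hi, h⟩⟩ := hmem (.inl (.inl i))
      · exact Or.inr ⟨e, fun hw => hw hi, decide i j e h⟩
      · exact Or.inl ⟨e, fun hw => hw hi, j, h⟩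
    · obtain ⟨j, ⟨e, hi, h⟩ | ⟨e, hi, h⟩⟩ := hmem (.inl (.inr i))
      · exact Or.inr ⟨e, hi, decide i j e h⟩
      · exact Or.inl ⟨e, fun hw => hw hi, j, h⟩

/-- The nodes of the tree with index `e` of the same length as `s` which are bounded by `s`. -/
def level (e : ℕ) (s : List ℕ) : Set (List ℕ) := {ν | ν ∈ treeAt e ∧ List.Forall₂ (· ≤ ·) ν s}

/-- The code of the node `ρ` of the tree with index `e`. -/
def nodeCode (e : ℕ) (ρ : List ℕ) : ℕ := Nat.pair e (Encodable.encode ρ)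

theorem level_finite (e : ℕ) (s : List ℕ) : (level e s).Finite := by
  refine Set.Finite.subset (s := {ν | List.Forall₂ (· ≤ ·) ν s}) ?_ fun ν hν => hν.2
  induction s with
  | nil => simp
  | cons a s ih =>
    refine ((Set.finite_Iic a).image2 List.cons ih).subset ?_
    rintro _ (_ | ⟨h, h'⟩)
    exact ⟨_, h, _, h', rfl⟩

theorem take_mem_level {e : ℕ} {s t ν : List ℕ} (h : ν ∈ level e t) (hp : s <+: t) :
    ν.take s.length ∈ level e s := by
  refine ⟨treeAt_prefixClosed e _ h.1 _ (List.take_prefix _ _), ?_⟩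
  obtain ⟨u, rfl⟩ := hp
  have := List.forall₂_take s.length h.2
  rwa [List.take_left] at this

theorem HasPathBelow.level_nonempty {e : ℕ} {s : List ℕ} (h : HasPathBelow e s) :
    (level e s).Nonempty := by
  obtain ⟨f, hf, hb⟩ := h
  refine ⟨(List.range s.length).map f, hf _, List.forall₂_iff_get.2 ⟨by simp, fun i h1 h2 => ?_⟩⟩
  simpa using hb i s[i] (by simp)

/-- The finite binary string `τ` may be extended to a set which, for every `e`, contains a chain
of nodes of the tree with index `e` bounded by the column `e` of the log. -/
structure Good (σ : List (ℕ × ℕ)) (τ : List Bool) : Prop where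
  mem : ∀ e ρ, τ[nodeCode e ρ]? = some true → ρ ∈ treeAt e
  chain : ∀ e ρ ρ', τ[nodeCode e ρ]? = some true → τ[nodeCode e ρ']? = some true →
    ρ <+: ρ' ∨ ρ' <+: ρ
  full : ∀ e s, s <+: col σ e → (∃ ν, ν ∈ level e s) →
    ∃ ν, ν ∈ level e s ∧ ¬ τ[nodeCode e ν]? = some false

theorem Good.mono {σ σ' : List (ℕ × ℕ)} {τ τ' : List Bool} (h : Good σ' τ') (hσ : σ <+: σ')
    (hτ : τ <+: τ') : Good σ τ where
  mem e ρ hρ := h.mem e ρ (getElem?_of_isPrefix hτ hρ)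
  chain e ρ ρ' hρ hρ' := h.chain e ρ ρ' (getElem?_of_isPrefix hτ hρ) (getElem?_of_isPrefix hτ hρ')
  full e s hs hν := (h.full e s (hs.trans (col_isPrefix hσ e)) hν).imp fun _ hν =>
    ⟨hν.1, fun hf => hν.2 (getElem?_of_isPrefix hτ hf)⟩

theorem exists_chain (e : ℕ) (c : List ℕ) : ∃ C : Set (List ℕ), (∀ ρ ∈ C, ρ ∈ treeAt e) ∧
    (∀ ρ ∈ C, ∀ ρ' ∈ C, ρ <+: ρ' ∨ ρ' <+: ρ) ∧
    ∀ s, s <+: c → (level e s).Nonempty → ∃ ν ∈ level e s, ν ∈ C := by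
  by_cases h : ∃ n, n ≤ c.length ∧ (level e (c.take n)).Nonempty
  · classical
    obtain ⟨m, hm⟩ := h
    let N := Nat.findGreatest (fun n => (level e (c.take n)).Nonempty) c.length
    obtain ⟨ν, hν⟩ : (level e (c.take N)).Nonempty :=
      Nat.findGreatest_spec (P := fun n => (level e (c.take n)).Nonempty) hm.1 hm.2
    refine ⟨{ρ | ρ <+: ν}, fun ρ hρ => treeAt_prefixClosed e _ hν.1 _ hρ,
      fun ρ hρ ρ' hρ' => List.prefix_or_prefix_of_prefix hρ hρ', fun s hs hne => ?_⟩
    have hsN : s <+: c.take N := by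
      have h1 : s.length ≤ N := Nat.le_findGreatest hs.length_le
        (by rwa [← List.prefix_iff_eq_take.1 hs])
      rw [List.prefix_iff_eq_take.1 hs]
      exact List.take_prefix_take_left h1
    exact ⟨_, take_mem_level hν hsN, List.take_prefix _ _⟩
  · refine ⟨∅, by simp, by simp, fun s hs hne => absurd ⟨s.length, hs.length_le, ?_⟩ h⟩
    rwa [← List.prefix_iff_eq_take.1 hs]

theorem exists_good (σ : List (ℕ × ℕ)) (L : ℕ) : ∃ τ, τ.length = L ∧ Good σ τ := by
  classical
  choose C h1 h2 h3 using fun e => exists_chain e (col σ e)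
  let τ : List Bool := (List.range L).map fun m =>
    decide (Denumerable.ofNat (List ℕ) m.unpair.2 ∈ C m.unpair.1)
  have hτ (e ρ b) : τ[nodeCode e ρ]? = some b → decide (ρ ∈ C e) = b := by
    intro h
    simp only [τ, List.getElem?_map, Option.map_eq_some_iff] at h
    obtain ⟨j, hj, rfl⟩ := h
    obtain ⟨_, rfl⟩ := List.getElem?_eq_some_iff.1 hj
    simp [nodeCode]
  refine ⟨τ, by simp [τ], fun e ρ h => h1 e ρ ?_, fun e ρ ρ' h h' => h2 e ρ ?_ ρ' ?_,
    fun e s hs hν => ?_⟩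
  · simpa using hτ _ _ _ h
  · simpa using hτ _ _ _ h
  · simpa using hτ _ _ _ h'
  · obtain ⟨ν, hν, hC⟩ := h3 e s hs hν
    exact ⟨ν, hν, fun hf => by simpa [hC] using hτ _ _ _ hf⟩

section

variable {α : Type} [Primcodable α]

@[fun_prop]
theorem computable_nodeCode {e : α → ℕ} {ρ : α → List ℕ} (he : Computable e)
    (hρ : Computable ρ) : Computable fun a => nodeCode (e a) (ρ a) := by
  unfold nodeCode; fun_prop

theorem Del.mem_level {e : α → ℕ} {s ν : α → List ℕ} (he : Computable e) (hs : Computable s)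
    (hν : Computable ν) : Del fun a => ν a ∈ level (e a) (s a) := by
  have h : Del fun a => ν a ∈ treeBelow (e a) (s a) ∧ (ν a).length = (s a).length :=
    (Del.mem_treeBelow he hs hν).and (Del.eq (by fun_prop) (by fun_prop))
  refine h.congr fun a => ?_
  simp only [level, treeBelow, Set.mem_ofPred_eq, List.forall₂_iff_get, and_assoc]
  refine and_congr_right fun _ => ?_
  rw [and_comm]
  refine and_congr_right fun _ => ⟨fun h i h1 h2 => h i _ _ (by simp) (by simp), ?_⟩
  intro h n v w hv hw
  obtain ⟨h1, rfl⟩ := List.getElem?_eq_some_iff.1 hv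
  obtain ⟨h2, rfl⟩ := List.getElem?_eq_some_iff.1 hw
  exact h n h1 h2

theorem Del.good {σ : α → List (ℕ × ℕ)} {τ : α → List Bool} (hσ : Computable σ)
    (hτ : Computable τ) : Del fun a => Good (σ a) (τ a) := by
  have h1 : Del fun a => ∀ e ρ, (τ a)[nodeCode e ρ]? = some true → ρ ∈ treeAt e := by
    refine Del.forall ?_
    refine Del.forall ?_
    exact Del.imp (Del.eq (by fun_prop) (by fun_prop)) (Del.mem_treeAt (by fun_prop) (by fun_prop))
  have h2 : Del fun a => ∀ e ρ ρ', (τ a)[nodeCode e ρ]? = some true →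
      (τ a)[nodeCode e ρ']? = some true → ρ <+: ρ' ∨ ρ' <+: ρ := by
    refine Del.forall ?_
    refine Del.forall ?_
    refine Del.forall ?_
    exact Del.imp (Del.eq (by fun_prop) (by fun_prop)) (Del.imp
      (Del.eq (by fun_prop) (by fun_prop)) (Del.or (Del.isPrefix (by fun_prop) (by fun_prop))
        (Del.isPrefix (by fun_prop) (by fun_prop))))
  have h3 : Del fun a => ∀ e s, s <+: col (σ a) e → (∃ ν, ν ∈ level e s) →
      ∃ ν, ν ∈ level e s ∧ ¬ (τ a)[nodeCode e ν]? = some false := by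
    refine Del.forall ?_
    refine Del.forall ?_
    refine Del.imp (Del.isPrefix (by fun_prop) (by fun_prop)) (Del.imp ?_ ?_)
    · refine Del.exists ?_
      exact Del.mem_level (by fun_prop) (by fun_prop) (by fun_prop)
    · refine Del.exists ?_
      exact Del.and (Del.mem_level (by fun_prop) (by fun_prop) (by fun_prop))
        (Del.not (Del.eq (by fun_prop) (by fun_prop)))
  exact (h1.and (h2.and h3)).congr fun a => ⟨fun h => ⟨h.1, h.2.1, h.2.2⟩,
    fun h => ⟨h.mem, h.chain, h.full⟩⟩

theorem Del.list_all {β : Type} {P : β → α → Prop} (h : ∀ b, Del (P b)) (D : List β) :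
    Del fun a => ∀ b ∈ D, P b a := by
  induction D with
  | nil => exact (Del.const True).congr fun a => by simp
  | cons b D ih => exact ((h b).and ih).congr fun a => by simp

end

theorem exists_seq_of_forall_length {Q : List Bool → Prop}
    (hQ : ∀ τ τ', τ <+: τ' → Q τ' → Q τ) (h : ∀ L, ∃ τ, τ.length = L ∧ Q τ) :
    ∃ Y : ℕ → Bool, ∀ k, Q ((List.range k).map Y) := by
  obtain ⟨Y, hY⟩ := exists_seq_of_forall_exists
    (Q := fun τ => ∀ L, ∃ τ', τ <+: τ' ∧ L ≤ τ'.length ∧ Q τ')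
    (fun L => let ⟨τ, h1, h2⟩ := h L; ⟨τ, List.nil_prefix, h1.ge, h2⟩) fun τ hτ => by
      by_contra! hc
      obtain ⟨L, hL⟩ := hc true
      obtain ⟨L', hL'⟩ := hc false
      obtain ⟨_, ⟨u, rfl⟩, h1, h2⟩ := hτ (max (max L L') (τ.length + 1))
      rcases u with _ | ⟨b, u⟩
      · simp at h1
      · have hp : τ ++ [b] <+: τ ++ b :: u := ⟨u, by simp⟩
        cases b
        · exact hL' _ hp (by omega) h2
        · exact hL _ hp (by omega) h2
  exact ⟨Y, fun k => let ⟨_, h1, _, h2⟩ := hY k 0; hQ _ _ h1 h2⟩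

theorem map_range_isPrefix {α : Type} (Y : ℕ → α) {k m : ℕ} (h : k ≤ m) :
    (List.range k).map Y <+: (List.range m).map Y := by
  refine List.IsPrefix.map _ ?_
  rw [List.prefix_iff_eq_take, List.length_range, List.take_range, min_eq_left h]

theorem getElem?_map_range {α : Type} (Y : ℕ → α) (k i : ℕ) (v : α) :
    ((List.range k).map Y)[i]? = some v ↔ i < k ∧ Y i = v := by
  simp only [List.getElem?_map, Option.map_eq_some_iff]
  constructor
  · rintro ⟨j, hj, rfl⟩
    obtain ⟨h, rfl⟩ := List.getElem?_eq_some_iff.1 hj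
    simpa using h
  · rintro ⟨h, rfl⟩
    exact ⟨i, by simp [h], rfl⟩

theorem exists_path_of_good {σ : ℕ → List (ℕ × ℕ)} {Y : ℕ → Bool}
    (hY : ∀ j k, Good (σ j) ((List.range k).map Y)) {e : ℕ}
    (hlen : ∀ L, ∃ j, L ≤ (col (σ j) e).length) (hpath : ∀ j, HasPathBelow e (col (σ j) e)) :
    ∃ f, IsPath (treeAt e) f ∧ (∀ k, Y (nodeCode e ((List.range k).map f)) = true) ∧
      ∀ ρ, Y (nodeCode e ρ) = true → ρ = (List.range ρ.length).map f := by
  have hnode : ∀ k, ∃ ν : List ℕ, ν.length = k ∧ Y (nodeCode e ν) = true := by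
    intro k
    obtain ⟨j, hj⟩ := hlen k
    let s := (col (σ j) e).take k
    have hs : s <+: col (σ j) e := List.take_prefix _ _
    obtain ⟨K, hK⟩ := ((level_finite e s).image (nodeCode e)).bddAbove
    obtain ⟨ν, hν, hc⟩ := (hY j (K + 1)).full e s hs ((hpath j).of_isPrefix hs).level_nonempty
    refine ⟨ν, ?_, ?_⟩
    · rw [hν.2.length_eq, List.length_take, min_eq_left hj]
    · rw [getElem?_map_range] at hc
      have := hK ⟨ν, hν, rfl⟩
      simpa [Nat.lt_succ_of_le this] using hc
  choose ν hlenν hYν using hnode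
  have hchain : ∀ ρ ρ', Y (nodeCode e ρ) = true → Y (nodeCode e ρ') = true →
      ρ <+: ρ' ∨ ρ' <+: ρ := fun ρ ρ' h h' =>
    (hY 0 (max (nodeCode e ρ) (nodeCode e ρ') + 1)).chain e ρ ρ'
      ((getElem?_map_range _ _ _ _).2 ⟨by omega, h⟩) ((getElem?_map_range _ _ _ _).2 ⟨by omega, h'⟩)
  let f : ℕ → ℕ := fun n => (ν (n + 1)).getD n 0
  have huniq : ∀ ρ, Y (nodeCode e ρ) = true → ρ = (List.range ρ.length).map f := by
    intro ρ hρ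
    refine List.ext_getElem (by simp) fun i h1 h2 => ?_
    have : ρ[i]? = (ν (i + 1))[i]? := by
      have hi : i < (ν (i + 1)).length := by rw [hlenν]; omega
      rcases hchain ρ _ hρ (hYν (i + 1)) with h | h
      · rw [List.getElem?_eq_getElem h1]
        exact (getElem?_of_isPrefix h (List.getElem?_eq_getElem h1)).symm
      · rw [List.getElem?_eq_getElem hi]
        exact getElem?_of_isPrefix h (List.getElem?_eq_getElem hi)
    simp [f, List.getD_eq_getElem?_getD, ← this, h1]
  have hf (k : ℕ) : (List.range k).map f = ν k := by
    have := huniq _ (hYν k)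
    rw [hlenν] at this
    exact this.symm
  refine ⟨f, fun k => ?_, fun k => by rw [hf, hYν], huniq⟩
  rw [hf]
  exact (hY 0 (nodeCode e (ν k) + 1)).mem e _ ((getElem?_map_range _ _ _ _).2 ⟨by omega, hYν k⟩)

theorem exists_seq_avoiding {ι : Type} [Encodable ι] {U : ι → List Bool → ℕ → Prop}
    (hU : ∀ i, Del fun x : List Bool × ℕ => U i x.1 x.2)
    (hmono : ∀ i τ τ' e, τ <+: τ' → U i τ e → U i τ' e) :
    ∃ Y : ℕ → Bool, (∀ e, IllFounded (treeAt e) → ∃ f, IsPath (treeAt e) f ∧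
        (∀ k, Y (nodeCode e ((List.range k).map f)) = true) ∧
        ∀ ρ, Y (nodeCode e ρ) = true → ρ = (List.range ρ.length).map f) ∧
      ∀ i A, IsTarget A → ¬ ∀ e, e ∈ A ↔ ∃ k, U i ((List.range k).map Y) e := by
  let G : List (ι × ℕ) → List (ℕ × ℕ) → List Bool → Prop := fun D σ τ =>
    Good σ τ ∧ ∀ x ∈ D, ¬ U x.1 τ x.2
  have hG (D D' σ σ' τ τ') (hD : D ⊆ D') (hσ : σ <+: σ') (hτ : τ <+: τ') (h : G D' σ' τ') :
      G D σ τ := ⟨h.1.mono hσ hτ, fun x hx hx' => h.2 x (hD hx) (hmono _ _ _ _ hτ hx')⟩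
  let V : List (ι × ℕ) × ι → List (ℕ × ℕ) → ℕ → Prop := fun Di σ e =>
    ∃ L, ∀ τ : List Bool, τ.length = L → G Di.1 σ τ → U Di.2 τ e
  have hV : ∀ Di, Del fun x : List (ℕ × ℕ) × ℕ => V Di x.1 x.2 := by
    rintro ⟨D, i⟩
    refine Del.exists ?_
    refine Del.forall ?_
    refine Del.imp (Del.eq (by fun_prop) (by fun_prop)) (Del.imp (Del.and
      (Del.good (by fun_prop) (by fun_prop)) ?_) ?_)
    · exact Del.list_all (P := fun (b : ι × ℕ) (x : ((List (ℕ × ℕ) × ℕ) × ℕ) × List Bool) =>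
        ¬ U b.1 x.2 b.2) (fun b => ((hU b.1).subst
          (u := fun x : ((List (ℕ × ℕ) × ℕ) × ℕ) × List Bool => (x.2, b.2)) (by fun_prop)).not) D
    · exact (hU i).subst (u := fun x : ((List (ℕ × ℕ) × ℕ) × ℕ) × List Bool => (x.2, x.1.1.2))
        (by fun_prop)
  obtain ⟨σ, hσ, hpath, havoid⟩ := exists_generic_logs hV fun Di σ σ' e hp ⟨L, hL⟩ =>
    ⟨L, fun τ h1 h2 => hL τ h1 (hG _ _ _ _ _ _ (List.Subset.refl _) hp List.prefix_rfl h2)⟩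
  let Inv : Type := {D : List (ι × ℕ) // ∀ j L, ∃ τ : List Bool, τ.length = L ∧ G D (σ j) τ}
  let _ : Preorder Inv :=
    { le := fun D D' => D.1 ⊆ D'.1
      le_refl := fun D => List.Subset.refl _
      le_trans := fun _ _ _ h h' => List.Subset.trans h h' }
  let target : Bool → Set ℕ := fun b => if b then WF else WFᶜ
  have htarget (b) : IsTarget (target b) := by cases b <;> simp [target, IsTarget]
  let 𝒟 : ι × Bool → Order.Cofinal Inv := fun ib =>
    ⟨{D | (∃ e ∉ target ib.2, ∃ j, V (D.1, ib.1) (σ j) e) ∨ ∃ e ∈ target ib.2, (ib.1, e) ∈ D.1},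
    fun D => by
      rcases havoid (D.1, ib.1) _ (htarget ib.2) with h | ⟨e, he, h⟩
      · exact ⟨D, Or.inl h, le_rfl⟩
      · refine ⟨⟨(ib.1, e) :: D.1, fun j L => ?_⟩, Or.inr ⟨e, he, by simp⟩,
          List.subset_cons_self _ _⟩
        have := h j
        simp only [V, not_exists, not_forall] at this
        obtain ⟨τ, h1, h2, h3⟩ := this L
        exact ⟨τ, h1, h2.1, by simpa using ⟨h3, fun a b hab => h2.2 (a, b) hab⟩⟩⟩
  let D : ℕ → Inv := Order.sequenceOfCofinals
    ⟨[], fun j L => (exists_good (σ j) L).imp fun τ h => ⟨h.1, h.2, by simp⟩⟩ 𝒟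
  have hD : Monotone D := Order.sequenceOfCofinals.monotone _ _
  have hmem (d) : ∃ n, D n ∈ 𝒟 d := ⟨_, Order.sequenceOfCofinals.encode_mem _ _ d⟩
  obtain ⟨Y, hY⟩ := exists_seq_of_forall_length (Q := fun τ => G (D τ.length).1 (σ τ.length) τ)
    (fun τ τ' hp h => hG _ _ _ _ _ _ (hD hp.length_le) (hσ _ _ hp.length_le) hp h)
    fun L => ((D L).2 L L).imp fun τ h => ⟨h.1, by rw [h.1]; exact h.2⟩
  have hYG (n j k : ℕ) : G (D n).1 (σ j) ((List.range k).map Y) := by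
    have := hY (max n (max j k))
    simp only [List.length_map, List.length_range] at this
    exact hG _ _ _ _ _ _ (hD (by omega)) (hσ _ _ (by omega)) (map_range_isPrefix Y (by omega)) this
  refine ⟨Y, fun e he => exists_path_of_good (fun j k => (hYG 0 j k).1) (hpath e he).1
    (hpath e he).2, fun i A hA h => ?_⟩
  obtain ⟨b, rfl⟩ : ∃ b, A = target b := by
    rcases hA with rfl | rfl
    · exact ⟨false, by simp [target]⟩
    · exact ⟨true, by simp [target]⟩
  obtain ⟨n, ⟨e, he, j, L, hL⟩ | ⟨e, he, hDe⟩⟩ := hmem (i, b)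
  · exact he ((h e).2 ⟨L, hL _ (by simp) (hYG n j L)⟩)
  · obtain ⟨k, hk⟩ := (h e).1 he
    exact (hYG n 0 k).2 _ hDe hk

theorem mem_rfind_zero (p : ℕ → Part ℕ) {v : ℕ} :
    (v ∈ Nat.rfind fun n => (fun m => decide (m = 0)) <$> p n) ↔
      0 ∈ p v ∧ ∀ m < v, ∃ b ∈ p m, b ≠ 0 := by
  refine Nat.mem_rfind.trans (and_congr ?_ (forall_congr' fun m => imp_congr_right fun _ => ?_))
  · simp [Part.mem_map_iff]
  · simp [Part.mem_map_iff]

theorem exists_forall_lt {P : ℕ → ℕ → Prop} {v : ℕ}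
    (hmono : ∀ l l' m, l ≤ l' → P l m → P l' m) (h : ∀ m < v, ∃ l, P l m) :
    ∃ l, ∀ m < v, P l m := by
  induction v with
  | zero => exact ⟨0, by simp⟩
  | succ v ih =>
    obtain ⟨l, hl⟩ := ih fun m hm => h m (by omega)
    obtain ⟨l', hl'⟩ := h v v.lt_succ_self
    refine ⟨max l l', fun m hm => ?_⟩
    rcases Nat.lt_succ_iff_lt_or_eq.1 hm with h | rfl
    · exact hmono _ _ _ (le_max_left _ _) (hl m h)
    · exact hmono _ _ _ (le_max_right _ _) hl'

theorem RecursiveIn.exists_functional {Y : ℕ → Bool} {f : ℕ →. ℕ}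
    (hf : RecursiveIn (fun n => (Y n).toNat) f) : ∃ Φ : List Bool → ℕ →. ℕ, Partrec₂ Φ ∧
      (∀ τ τ' n v, τ <+: τ' → v ∈ Φ τ n → v ∈ Φ τ' n) ∧
      ∀ n v, v ∈ f n ↔ ∃ k, v ∈ Φ ((List.range k).map Y) n := by
  induction hf with
  | zero =>
    exact ⟨fun _ => pure 0, (Computable.const 0).partrec, fun _ _ _ _ _ h => h, by simp⟩
  | succ =>
    exact ⟨fun _ n => Part.some n.succ, (Computable.succ.comp Computable.snd).partrec,
      fun _ _ _ _ _ h => h, by simp⟩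
  | left =>
    exact ⟨fun _ n => Part.some n.unpair.1, Computable.partrec
      (f := fun x : List Bool × ℕ => x.2.unpair.1) (by fun_prop), fun _ _ _ _ _ h => h, by simp⟩
  | right =>
    exact ⟨fun _ n => Part.some n.unpair.2, Computable.partrec
      (f := fun x : List Bool × ℕ => x.2.unpair.2) (by fun_prop), fun _ _ _ _ _ h => h, by simp⟩
  | oracle =>
    refine ⟨fun τ n => Part.ofOption (τ[n]?.map Bool.toNat), ?_, ?_, fun n v => ?_⟩
    · have : Computable Bool.toNat := (Primrec.dom_finite _).to_comp
      exact Computable.ofOption (f := fun x : List Bool × ℕ => x.1[x.2]?.map Bool.toNat)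
        (Computable.option_map (by fun_prop) (this.comp Computable.snd))
    · intro τ τ' n v hp
      simp only [Part.mem_ofOption, Option.mem_def, Option.map_eq_some_iff]
      exact fun ⟨b, h, h'⟩ => ⟨b, getElem?_of_isPrefix hp h, h'⟩
    · simp only [PFun.coe_val, Part.mem_some_iff, Part.mem_ofOption, Option.mem_def,
        Option.map_eq_some_iff, getElem?_map_range]
      exact ⟨fun h => ⟨n + 1, Y n, ⟨n.lt_succ_self, rfl⟩, h.symm⟩,
        fun ⟨k, b, ⟨_, h⟩, h'⟩ => by rw [← h', h]⟩
  | @pair f g _ _ ihf ihg =>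
    obtain ⟨Φ, hΦ, hm, hv⟩ := ihf
    obtain ⟨Ψ, hΨ, hm', hv'⟩ := ihg
    refine ⟨fun τ n => (Φ τ n).bind fun a => (Ψ τ n).map fun b => Nat.pair a b, ?_, ?_,
      fun n v => ?_⟩
    · refine Partrec.bind (f := fun x : List Bool × ℕ => Φ x.1 x.2) hΦ (Partrec.map
        (f := fun x : (List Bool × ℕ) × ℕ => Ψ x.1.1 x.1.2) (Partrec₂.comp (f := Ψ) hΨ
        (by fun_prop) (by fun_prop)) ?_)
      exact Computable.to₂ (f := fun x : ((List Bool × ℕ) × ℕ) × ℕ => Nat.pair x.1.2 x.2)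
        (by fun_prop)
    · simp only [Part.mem_bind_iff, Part.mem_map_iff]
      exact fun τ τ' n v hp ⟨a, ha, b, hb, h⟩ => ⟨a, hm _ _ _ _ hp ha, b, hm' _ _ _ _ hp hb, h⟩
    · simp only [Part.mem_bind_iff, Part.mem_map_iff, Seq.seq, Part.map_eq_map, hv, hv']
      constructor
      · rintro ⟨_, ⟨a, ⟨k, ha⟩, rfl⟩, b, ⟨l, hb⟩, rfl⟩
        exact ⟨max k l, a, hm _ _ _ _ (map_range_isPrefix Y (le_max_left _ _)) ha, b,
          hm' _ _ _ _ (map_range_isPrefix Y (le_max_right _ _)) hb, rfl⟩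
      · rintro ⟨k, a, ha, b, hb, rfl⟩
        exact ⟨_, ⟨a, ⟨k, ha⟩, rfl⟩, b, ⟨k, hb⟩, rfl⟩
  | @comp f g _ _ ihf ihg =>
    obtain ⟨Φ, hΦ, hm, hv⟩ := ihf
    obtain ⟨Ψ, hΨ, hm', hv'⟩ := ihg
    refine ⟨fun τ n => (Ψ τ n).bind fun a => Φ τ a, ?_, ?_, fun n v => ?_⟩
    · exact Partrec.bind (f := fun x : List Bool × ℕ => Ψ x.1 x.2) hΨ
        (hΦ.comp (Computable.fst.comp Computable.fst) Computable.snd)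
    · simp only [Part.mem_bind_iff]
      exact fun τ τ' n v hp ⟨a, ha, h⟩ => ⟨a, hm' _ _ _ _ hp ha, hm _ _ _ _ hp h⟩
    · change v ∈ (g n).bind (fun a => f a) ↔ _
      simp only [Part.mem_bind_iff, hv, hv']
      constructor
      · rintro ⟨a, ⟨k, ha⟩, l, hb⟩
        exact ⟨max k l, a, hm' _ _ _ _ (map_range_isPrefix Y (le_max_left _ _)) ha,
          hm _ _ _ _ (map_range_isPrefix Y (le_max_right _ _)) hb⟩
      · rintro ⟨k, a, ha, hb⟩
        exact ⟨a, ⟨k, ha⟩, k, hb⟩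
  | @prec f g _ _ ihf ihg =>
    obtain ⟨Φ, hΦ, hm, hv⟩ := ihf
    obtain ⟨Ψ, hΨ, hm', hv'⟩ := ihg
    let Θ (τ : List Bool) (a n : ℕ) : Part ℕ := n.rec (Φ τ a) fun y IH =>
      IH.bind fun i => Ψ τ (Nat.pair a (Nat.pair y i))
    have hΘ (τ τ' a n v) (hp : τ <+: τ') (h : v ∈ Θ τ a n) : v ∈ Θ τ' a n := by
      induction n generalizing v with
      | zero => exact hm _ _ _ _ hp h
      | succ n ih =>
        obtain ⟨i, hi, h⟩ := Part.mem_bind_iff.1 h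
        exact Part.mem_bind_iff.2 ⟨i, ih _ hi, hm' _ _ _ _ hp h⟩
    refine ⟨fun τ n => Θ τ n.unpair.1 n.unpair.2, ?_, fun τ τ' n v => hΘ _ _ _ _ _,
      fun n v => ?_⟩
    · refine Partrec.nat_rec (f := fun x : List Bool × ℕ => x.2.unpair.2)
        (g := fun x => Φ x.1 x.2.unpair.1)
        (h := fun x yi => Ψ x.1 (Nat.pair x.2.unpair.1 (Nat.pair yi.1 yi.2)))
        (by fun_prop) (hΦ.comp (by fun_prop) (by fun_prop)) ?_
      exact Partrec₂.comp (f := Ψ) (g := fun x : (List Bool × ℕ) × ℕ × ℕ => x.1.1)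
        (h := fun x => Nat.pair x.1.2.unpair.1 (Nat.pair x.2.1 x.2.2)) hΨ (by fun_prop)
        (by fun_prop)
    · suffices H : ∀ a n v, (v ∈ (n.rec (f a) fun y IH => IH.bind fun i =>
          g (Nat.pair a (Nat.pair y i)) : Part ℕ)) ↔ ∃ k, v ∈ Θ ((List.range k).map Y) a n from
        H _ _ _
      intro a n
      induction n with
      | zero => exact hv _
      | succ n ih =>
        intro v
        simp only [Part.mem_bind_iff, hv', ih, Θ]
        constructor
        · rintro ⟨i, ⟨k, hi⟩, l, h⟩
          exact ⟨max k l, i, hΘ _ _ _ _ _ (map_range_isPrefix Y (le_max_left _ _)) hi,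
            hm' _ _ _ _ (map_range_isPrefix Y (le_max_right _ _)) h⟩
        · rintro ⟨k, i, hi, h⟩
          exact ⟨i, ⟨k, hi⟩, k, h⟩
  | @rfind f _ ihf =>
    obtain ⟨Φ, hΦ, hm, hv⟩ := ihf
    refine ⟨fun τ a => Nat.rfind fun n => (fun m => decide (m = 0)) <$> Φ τ (Nat.pair a n), ?_, ?_,
      fun n v => ?_⟩
    · refine Partrec.rfind (p := fun (x : List Bool × ℕ) n =>
        (fun m => decide (m = 0)) <$> Φ x.1 (Nat.pair x.2 n)) ?_
      refine Partrec.map (f := fun x : (List Bool × ℕ) × ℕ => Φ x.1.1 (Nat.pair x.1.2 x.2))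
        (Partrec₂.comp (f := Φ) hΦ (by fun_prop) (by fun_prop)) ?_
      exact ((Primrec.eq.comp Primrec.snd (Primrec.const 0)).decide.to_comp).to₂
    · intro τ τ' n v hp h
      rw [mem_rfind_zero fun m => Φ _ (Nat.pair n m)] at h ⊢
      exact ⟨hm _ _ _ _ hp h.1, fun m hlt => (h.2 m hlt).imp fun b hb =>
        ⟨hm _ _ _ _ hp hb.1, hb.2⟩⟩
    · rw [mem_rfind_zero fun m => f (Nat.pair n m)]
      simp only [mem_rfind_zero fun m => Φ _ (Nat.pair n m), hv]
      constructor
      · rintro ⟨⟨k, h⟩, h'⟩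
        have key : ∃ l, ∀ m < v, ∃ b, b ∈ Φ ((List.range l).map Y) (Nat.pair n m) ∧ b ≠ 0 :=
          exists_forall_lt (fun l l' m hl ⟨b, hb⟩ =>
            ⟨b, hm _ _ _ _ (map_range_isPrefix Y hl) hb.1, hb.2⟩) fun m hlt =>
              let ⟨b, ⟨l, hb⟩, hb'⟩ := h' m hlt
              ⟨l, b, hb, hb'⟩
        obtain ⟨l, hl⟩ := key
        exact ⟨max k l, hm _ _ _ _ (map_range_isPrefix Y (le_max_left _ _)) h, fun m hlt =>
          (hl _ hlt).imp fun b hb =>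
            ⟨hm _ _ _ _ (map_range_isPrefix Y (le_max_right _ _)) hb.1, hb.2⟩⟩
      · rintro ⟨k, h, h'⟩
        exact ⟨⟨k, h⟩, fun m hlt => (h' m hlt).imp fun b hb => ⟨⟨k, hb.1⟩, hb.2⟩⟩

/-- With oracle prefix `τ`, the functional with index `i` maps `n` to `v`. -/
def Outputs (i : ℕ) (τ : List Bool) (n v : ℕ) : Prop :=
  ∃ τ', τ' <+: τ ∧ v ∈ codeFn i (Nat.pair (Encodable.encode τ') n)

theorem Outputs.mono {i n v : ℕ} {τ τ' : List Bool} (h : Outputs i τ n v) (hp : τ <+: τ') :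
    Outputs i τ' n v :=
  h.imp fun _ h => ⟨h.1.trans hp, h.2⟩

theorem Del.outputs {α : Type} [Primcodable α] (i : ℕ) {τ : α → List Bool} {n v : α → ℕ}
    (hτ : Computable τ) (hn : Computable n) (hv : Computable v) :
    Del fun a => Outputs i (τ a) (n a) (v a) := by
  refine Del.exists ?_
  exact Del.and (Del.isPrefix (by fun_prop) (by fun_prop))
    (Del.mem_codeFn (by fun_prop) (by fun_prop) (by fun_prop))

theorem chi_setOf (Y : ℕ → Bool) : chi {n | Y n = true} = fun n => (Y n).toNat := by
  ext n
  cases h : Y n <;> simp [chi, h]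

theorem RecursiveIn.exists_index {Y : ℕ → Bool} {f : ℕ →. ℕ}
    (hf : RecursiveIn (chi {n | Y n = true}) f) :
    ∃ i, ∀ n v, v ∈ f n ↔ ∃ k, Outputs i ((List.range k).map Y) n v := by
  rw [chi_setOf] at hf
  obtain ⟨Φ, hΦ, hm, hv⟩ := hf.exists_functional
  obtain ⟨c, hc⟩ := Code.exists_code.1 hΦ
  have (τ : List Bool) (n : ℕ) : codeFn (Encodable.encode c) (Nat.pair (Encodable.encode τ) n) =
      Φ τ n := by
    simp [codeFn, hc, Part.map_id']
  refine ⟨Encodable.encode c, fun n v => (hv n v).trans (exists_congr fun k => ?_)⟩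
  simp only [Outputs, this]
  exact ⟨fun h => ⟨_, List.prefix_rfl, h⟩, fun ⟨τ', h, h'⟩ => hm _ _ _ _ h h'⟩

theorem PartrecIn.exists_index {Y : ℕ → Bool} {F : ℕ × ℕ →. ℕ}
    (hF : PartrecIn (chi {n | Y n = true}) F) :
    ∃ i, ∀ e n v, v ∈ F (e, n) ↔ ∃ k, Outputs i ((List.range k).map Y) (Nat.pair e n) v := by
  obtain ⟨i, hi⟩ := RecursiveIn.exists_index hF
  refine ⟨i, fun e n v => ?_⟩
  rw [← hi]
  simp [Part.map_id']

theorem RecursiveIn.of_partrec {O : ℕ → ℕ} {f : ℕ →. ℕ} (hf : Nat.Partrec f) :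
    RecursiveIn O f := by
  induction hf with
  | zero => exact .zero
  | succ => exact .succ
  | left => exact .left
  | right => exact .right
  | pair _ _ hf hg => exact .pair hf hg
  | comp _ _ hf hg => exact .comp hf hg
  | prec _ _ hf hg => exact .prec hf hg
  | rfind _ hf => exact .rfind hf

theorem RecursiveIn.of_computable {O : ℕ → ℕ} {f : ℕ → ℕ} (hf : Computable f) :
    RecursiveIn O f :=
  .of_partrec (Partrec.nat_iff.1 hf)

theorem RecursiveIn.search {O q t r : ℕ → ℕ} (hq : Computable q) (ht : Computable t)
    (hr : Computable r) : RecursiveIn O fun a =>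
      (Nat.rfind fun c => Part.some
        (decide (t (Nat.pair (Nat.pair a c) (O (q (Nat.pair a c)))) = 0))).map
          fun c => r (Nat.pair a c) := by
  have hid : RecursiveIn O fun a => Part.some a := .of_computable Computable.id
  have hO : RecursiveIn O fun a => Part.some (O a) := .oracle
  have hq : RecursiveIn O fun a => Part.some (q a) := .of_computable hq
  have ht : RecursiveIn O fun a => Part.some (t a) := .of_computable ht
  have hr : RecursiveIn O fun a => Part.some (r a) := .of_computable hr
  have := hr.comp (hid.pair (ht.comp (hid.pair (hO.comp hq))).rfind)
  simpa [Seq.seq, ← Part.bind_some_eq_map, Part.bind_assoc] using this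

theorem unifHighForPaths_of_nodeCode {Y : ℕ → Bool}
    (hY : ∀ e, IllFounded (treeAt e) → ∃ f, IsPath (treeAt e) f ∧
      (∀ k, Y (nodeCode e ((List.range k).map f)) = true) ∧
      ∀ ρ, Y (nodeCode e ρ) = true → ρ = (List.range ρ.length).map f) :
    UnifHighForPaths {n | Y n = true} := by
  let q : ℕ → ℕ := fun x => Nat.pair x.unpair.1.unpair.1 x.unpair.2
  let t : ℕ → ℕ := fun y => bif decide ((y.unpair.2,
    (Denumerable.ofNat (List ℕ) y.unpair.1.unpair.2).length) =
      (1, y.unpair.1.unpair.1.unpair.2 + 1)) then 0 else 1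
  let r : ℕ → ℕ := fun x => (Denumerable.ofNat (List ℕ) x.unpair.2)[x.unpair.1.unpair.2]?.getD 0
  have hofNat : Computable (Denumerable.ofNat (List ℕ)) := Computable.ofNat _
  have hsucc : Computable fun n : ℕ => n + 1 := Computable.succ
  have ht : Computable t :=
    Computable.cond (Primrec.eq.decide.to_comp.comp (by fun_prop) (by fun_prop))
      (Computable.const 0) (Computable.const 1)
  let F : ℕ → Part ℕ := fun a =>
    (Nat.rfind fun c => Part.some (decide (t (Nat.pair (Nat.pair a c)
      (chi {n | Y n = true} (q (Nat.pair a c)))) = 0))).map fun c => r (Nat.pair a c)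
  have hF : RecursiveIn (chi {n | Y n = true}) F :=
    RecursiveIn.search (by fun_prop) ht (Computable.option_getD (by fun_prop) (Computable.const 0))
  have htest (e n c) : t (Nat.pair (Nat.pair (Nat.pair e n) c) (chi {n | Y n = true}
      (q (Nat.pair (Nat.pair e n) c)))) = 0 ↔
      Y (Nat.pair e c) = true ∧ (Denumerable.ofNat (List ℕ) c).length = n + 1 := by
    simp [t, q, chi, Bool.cond_eq_ite]
  refine ⟨fun x => F (Nat.pair x.1 x.2), ?_, fun e he => ?_⟩
  · simpa [PartrecIn, Part.map_id'] using hF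
  · obtain ⟨f, hf, hf1, hf2⟩ := hY e he
    refine ⟨f, hf, fun n => Part.eq_some_iff.2 ((Part.mem_map_iff _).2 ?_)⟩
    refine (Part.dom_iff_mem.1 (Nat.rfind_dom.2 ?_)).imp fun c hc => ⟨hc, ?_⟩
    · exact ⟨Encodable.encode ((List.range (n + 1)).map f), Part.mem_some_iff.2 (decide_eq_true
        ((htest e n _).2 ⟨hf1 _, by simp⟩)).symm, fun _ => trivial⟩
    · obtain ⟨h1, h2⟩ := (htest e n c).1
        (of_decide_eq_true (Part.mem_some_iff.1 (Nat.rfind_spec hc)).symm)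
      have h3 := hf2 (Denumerable.ofNat (List ℕ) c) (by simpa [nodeCode] using h1)
      rw [h2] at h3
      simp [r, h3]

theorem not_retHighForPaths {Y : ℕ → Bool}
    (hY : ∀ i, ¬ ∀ e, e ∈ WFᶜ ↔ ∃ k v, Outputs i ((List.range k).map Y) (Nat.pair e 0) v) :
    ¬ RetHighForPaths {n | Y n = true} := by
  rintro ⟨F, hF, hp, hd⟩
  obtain ⟨i, hi⟩ := hF.exists_index
  refine hY i fun e => ?_
  rw [exists_comm]
  simp only [← hi, WF, Set.mem_compl_iff, Set.mem_ofPred_eq, not_not, ← Part.dom_iff_mem]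
  constructor
  · intro h
    obtain ⟨g, -, hg⟩ := hp e h
    rw [hg 0]
    trivial
  · exact fun h => by_contra fun h' => hd e h' 0 h

theorem not_loqHighForPaths {Y : ℕ → Bool}
    (hY : ∀ i, ¬ ∀ e, e ∈ WF ↔ ∃ k ν, ν ∉ treeAt e ∧ ∀ m v, ν[m]? = some v →
      Outputs i ((List.range k).map Y) (Nat.pair e m) v) :
    ¬ LoqHighForPaths {n | Y n = true} := by
  rintro ⟨F, hF, hp⟩
  obtain ⟨i, hi⟩ := hF.exists_index
  refine hY i fun e => ?_
  simp only [PFun.coe_val, Part.mem_some_iff] at hi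
  constructor
  · intro h
    obtain ⟨n, hn⟩ : ∃ n, (List.range n).map (fun m => F (e, m)) ∉ treeAt e := by
      by_contra! hc
      exact h ⟨_, hc⟩
    obtain ⟨k, hk⟩ := exists_forall_lt (v := n)
      (P := fun k m => Outputs i ((List.range k).map Y) (Nat.pair e m) (F (e, m)))
      (fun l l' m hl h => h.mono (map_range_isPrefix Y hl)) fun m _ => (hi e m _).1 rfl
    refine ⟨k, _, hn, fun m v hv => ?_⟩
    obtain ⟨hm, rfl⟩ := (getElem?_map_range _ _ _ _).1 hv
    exact hk m hm
  · rintro ⟨k, ν, hν, h⟩ hill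
    have : ν = (List.range ν.length).map fun m => F (e, m) := by
      refine List.ext_getElem? fun m => ?_
      rcases lt_or_ge m ν.length with hm | hm
      · rw [List.getElem?_eq_getElem hm, eq_comm, getElem?_map_range]
        exact ⟨hm, ((hi e m _).2 ⟨k, h _ _ (List.getElem?_eq_getElem hm)⟩).symm⟩
      · simp [hm]
    exact hν (this ▸ hp e hill _)

/-- There is a set that is uniformly high for paths but neither
reticently nor loquaciously high for paths. -/
theorem exists_unifHighForPaths_neither_ret_nor_loq :
    ∃ X : Set ℕ, UnifHighForPaths X ∧ ¬ RetHighForPaths X ∧ ¬ LoqHighForPaths X := by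
  let U : ℕ × Bool → List Bool → ℕ → Prop := fun ib τ e =>
    if ib.2 then ∃ v, Outputs ib.1 τ (Nat.pair e 0) v
    else ∃ ν, ν ∉ treeAt e ∧ ∀ m v, ν[m]? = some v → Outputs ib.1 τ (Nat.pair e m) v
  have hU : ∀ ib, Del fun x : List Bool × ℕ => U ib x.1 x.2 := by
    rintro ⟨i, b⟩
    cases b
    · refine (Del.congr ?_ fun x => by
        rw [show U (i, false) x.1 x.2 = _ from if_neg Bool.false_ne_true])
      refine Del.exists ?_
      refine Del.and (Del.mem_treeAt (by fun_prop) (by fun_prop)).not ?_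
      refine Del.forall ?_
      refine Del.forall ?_
      exact Del.imp (Del.eq (by fun_prop) (by fun_prop))
        (Del.outputs i (by fun_prop) (by fun_prop) (by fun_prop))
    · refine (Del.congr ?_ fun x => by rw [show U (i, true) x.1 x.2 = _ from if_pos rfl])
      refine Del.exists ?_
      exact Del.outputs i (by fun_prop) (by fun_prop) (by fun_prop)
  obtain ⟨Y, hY, hA⟩ := exists_seq_avoiding hU fun ⟨i, b⟩ τ τ' e hp => by
    cases b
    · exact fun ⟨ν, h, h'⟩ => ⟨ν, h, fun m v hm => (h' m v hm).mono hp⟩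
    · exact fun ⟨v, h⟩ => ⟨v, h.mono hp⟩
  exact ⟨{n | Y n = true}, unifHighForPaths_of_nodeCode hY,
    not_retHighForPaths fun i h => hA (i, true) _ (Or.inl rfl) h,
    not_loqHighForPaths fun i h => hA (i, false) _ (Or.inr rfl) h⟩

end CFT
end

section
/- If X ⊆ ℕ is high for tight descending sequences, then WF = {e : T_e is well-founded} is limit-computable relative to X: there is a total X-computable g : ℕ × ℕ → ℕ such that for every e, g(e,s) equals the characteristic function of WF at e for all sufficiently large s. (Equivalently, by the Shoenfield limit lemma, the Turing jump of X computes the Π¹₁-complete set WF, i.e., X′ ≥_T Kleene's O.) -/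
namespace CFT

open Nat.Partrec (Code)

theorem computableIn_nat_iff {O : ℕ → ℕ} {f : ℕ → ℕ} :
    ComputableIn O f ↔ RecursiveIn O (f : ℕ →. ℕ) := by
  have : (fun n => Part.bind (Part.ofOption (Encodable.decode (α := ℕ) n)) fun a =>
      ((f : ℕ →. ℕ) a).map Encodable.encode) = (f : ℕ →. ℕ) := by
    funext n
    simp
  rw [ComputableIn, PartrecIn, this]

/-- Post-processing an `O`-computable function by a computable one. -/
theorem ComputableIn.postcomp {O : ℕ → ℕ} {f : ℕ → ℕ} {G : ℕ → ℕ → ℕ}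
    (hf : ComputableIn O f) (hG : Computable₂ G) :
    ComputableIn O fun a : ℕ × ℕ => G a.1 (f a.2) := by
  have hG' : Nat.Partrec ((fun n : ℕ => G n.unpair.1 n.unpair.2 : ℕ → ℕ) : ℕ →. ℕ) :=
    Partrec.nat_iff.1 <| Computable.partrec <|
      hG.comp (Computable.fst.comp Computable.unpair) (Computable.snd.comp Computable.unpair)
  have h := RecursiveIn.comp (RecursiveIn.of_partrec (O := O) hG')
    (RecursiveIn.pair RecursiveIn.left
      (RecursiveIn.comp (computableIn_nat_iff.1 hf) RecursiveIn.right))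
  unfold ComputableIn PartrecIn
  have heq : ∀ (F : ℕ → ℕ) (n : ℕ), (Part.some n >>= (F : ℕ →. ℕ)) = Part.some (F n) :=
    fun _ _ => Part.bind_some _ _
  convert h using 2 with n
  simp [Seq.seq, heq]

/-! ### Bounded quantification -/

theorem primrecRel_exists_lt {α : Type} [Primcodable α] {R : ℕ → α → Prop} (hR : PrimrecRel R) :
    PrimrecRel fun n a => ∃ i < n, R i a :=
  (hR.exists_mem_list.comp (Primrec.list_range.comp Primrec.fst) Primrec.snd).of_eq (by simp)

theorem primrecRel_forall_lt {α : Type} [Primcodable α] {R : ℕ → α → Prop} (hR : PrimrecRel R) :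
    PrimrecRel fun n a => ∀ i < n, R i a :=
  (hR.forall_mem_list.comp (Primrec.list_range.comp Primrec.fst) Primrec.snd).of_eq (by simp)

/-! ### The Kleene–Brouwer order -/

/-- The `i`-th entry of `σ`, where `σ` is continued by `⊤` past its end. -/
def entry (σ : List ℕ) (i : ℕ) : WithTop ℕ := if i < σ.length then (σ.getD i 0 : ℕ) else ⊤

theorem entry_of_le {σ : List ℕ} {i : ℕ} (h : σ.length ≤ i) : entry σ i = ⊤ :=
  if_neg h.not_gt

theorem entry_eq_top_iff {σ : List ℕ} {i : ℕ} : entry σ i = ⊤ ↔ σ.length ≤ i := by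
  unfold entry
  split_ifs with h <;> simp <;> omega

theorem entry_eq_coe_iff {σ : List ℕ} {i a : ℕ} :
    entry σ i = a ↔ i < σ.length ∧ σ.getD i 0 = a := by
  unfold entry
  split_ifs with h <;> simp [h]

theorem entry_eq_iff {σ τ : List ℕ} {i : ℕ} : entry σ i = entry τ i ↔ σ[i]? = τ[i]? := by
  unfold entry
  split_ifs with h h' h'
  · simp [h, h']
  · simp [h, Nat.not_lt.1 h']
  · simp [h', Nat.not_lt.1 h]
  · rw [List.getElem?_eq_none (Nat.not_lt.1 h), List.getElem?_eq_none (Nat.not_lt.1 h')]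
    simp

theorem entry_injective : Function.Injective entry := fun _ _ h =>
  List.ext_getElem? fun i => entry_eq_iff.1 (congrFun h i)

theorem toLex_lt_toLex_iff {β : Type} [LT β] {x y : ℕ → β} :
    toLex x < toLex y ↔ ∃ k, (∀ j < k, x j = y j) ∧ x k < y k :=
  Iff.rfl

/-- The Kleene–Brouwer order on finite sequences. -/
def KB (σ τ : List ℕ) : Prop := toLex (entry σ) < toLex (entry τ)

theorem kb_iff {σ τ : List ℕ} :
    KB σ τ ↔ ∃ i < σ.length, (∀ j < i, σ[j]? = τ[j]?) ∧
      (τ.length ≤ i ∨ σ.getD i 0 < τ.getD i 0) := by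
  rw [KB, toLex_lt_toLex_iff]
  simp only [entry_eq_iff]
  refine exists_congr fun i => ?_
  unfold entry
  split_ifs with h h'
  · simp [h, h']
  · simp [h, Nat.not_lt.1 h']
  · simp [h]
  · simp [h]

theorem primrecRel_kb : PrimrecRel KB := by
  have agree : PrimrecRel fun (j : ℕ) (p : List ℕ × List ℕ) => p.1[j]? = p.2[j]? :=
    Primrec.eq.comp
      (Primrec.list_getElem?.comp (Primrec.fst.comp Primrec.snd) Primrec.fst)
      (Primrec.list_getElem?.comp (Primrec.snd.comp Primrec.snd) Primrec.fst)
  have less : PrimrecRel fun (i : ℕ) (p : List ℕ × List ℕ) =>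
      (∀ j < i, p.1[j]? = p.2[j]?) ∧ (p.2.length ≤ i ∨ p.1.getD i 0 < p.2.getD i 0) :=
    PrimrecPred.and (primrecRel_forall_lt agree) <| PrimrecPred.or
      (Primrec.nat_le.comp (Primrec.list_length.comp (Primrec.snd.comp Primrec.snd)) Primrec.fst)
      (Primrec.nat_lt.comp
        ((Primrec.list_getD 0).comp (Primrec.fst.comp Primrec.snd) Primrec.fst)
        ((Primrec.list_getD 0).comp (Primrec.snd.comp Primrec.snd) Primrec.fst))
  exact ((primrecRel_exists_lt less).comp (Primrec.list_length.comp Primrec.fst)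
    (Primrec.id (α := List ℕ × List ℕ))).of_eq fun p => kb_iff.symm

theorem le_apply_of_lex_le {β : Type} [LinearOrder β] {x y : ℕ → β} {k : ℕ}
    (hxy : toLex x ≤ toLex y) (h : ∀ j < k, x j = y j) : x k ≤ y k := by
  by_contra! hlt
  exact hxy.not_gt ⟨k, fun j hj => (h j hj).symm, hlt⟩

/-- A decreasing sequence for the lexicographic order over a well-order stabilizes on every
initial segment. -/
theorem lex_antitone_stabilizes {β : Type} [LinearOrder β] [WellFoundedLT β] {a : ℕ → ℕ → β}
    (ha : Antitone fun m => toLex (a m)) (k : ℕ) :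
    ∃ M, ∀ m ≥ M, ∀ i < k, a m i = a M i := by
  induction k with
  | zero => exact ⟨0, by simp⟩
  | succ k ih =>
    obtain ⟨M, hM⟩ := ih
    obtain ⟨_, ⟨N, hN, rfl⟩, hmin⟩ := wellFounded_lt.has_min ((fun m => a m k) '' Set.Ici M)
      ⟨_, M, Set.self_mem_Ici, rfl⟩
    have hagree : ∀ m ≥ N, ∀ i < k, a m i = a N i := fun m hm i hi =>
      (hM m (le_trans hN hm) i hi).trans (hM N hN i hi).symm
    refine ⟨N, fun m hm i hi => ?_⟩
    rcases Nat.lt_succ_iff_lt_or_eq.1 hi with hi | rfl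
    · exact hagree m hm i hi
    · exact (le_apply_of_lex_le (ha hm) (hagree m hm)).antisymm
        (not_lt.1 (hmin _ ⟨m, le_trans hN hm, rfl⟩))

/-- Every sequence descending in the Kleene–Brouwer order converges pointwise. -/
theorem kb_desc_converges {s : ℕ → List ℕ} (hs : ∀ m, KB (s (m + 1)) (s m)) :
    ∃ p : ℕ → ℕ, ∀ k, ∃ M, ∀ m ≥ M, ∀ i < k, entry (s m) i = p i := by
  have hanti : StrictAnti fun m => toLex (entry (s m)) := strictAnti_nat_of_succ_lt hs
  choose M hM using lex_antitone_stabilizes hanti.antitone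
  have hne : ∀ i, entry (s (M (i + 1))) i ≠ ⊤ := by
    intro i htop
    set N := M (i + 1)
    refine (hanti N.lt_succ_self).ne (congrArg toLex (funext fun j => ?_))
    rcases Nat.lt_or_ge j (i + 1) with hj | hj
    · exact hM (i + 1) _ N.le_succ j hj
    · have h1 := hM (i + 1) _ N.le_succ i i.lt_succ_self
      rw [htop, entry_eq_top_iff] at h1
      rw [entry_eq_top_iff] at htop
      rw [entry_of_le (by omega), entry_of_le (by omega)]
  choose p hp using fun i => WithTop.ne_top_iff_exists.1 (hne i)
  refine ⟨p, fun k => ⟨M k, fun m hm i hi => ?_⟩⟩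
  refine Eq.trans ?_ (hp i).symm
  rw [hM k m hm i hi, ← hM k (max (M k) (M (i + 1))) (le_max_left _ _) i hi,
    hM (i + 1) _ (le_max_right _ _) i i.lt_succ_self]

/-- The Kleene–Brouwer order on (the codes of the elements of) `T`. -/
def kbOrd (T : Set (List ℕ)) : LinOrd where
  dom := {a | Denumerable.ofNat (List ℕ) a ∈ T}
  lt a b := (Denumerable.ofNat (List ℕ) a ∈ T ∧ Denumerable.ofNat (List ℕ) b ∈ T) ∧
    KB (Denumerable.ofNat (List ℕ) a) (Denumerable.ofNat (List ℕ) b)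

theorem kbOrd_isValid (T : Set (List ℕ)) : (kbOrd T).IsValid := by
  refine ⟨fun a b h => h.1, fun a h => lt_irrefl _ h.2,
    fun a b c h h' => ⟨⟨h.1.1, h'.1.2⟩, lt_trans h.2 h'.2⟩, fun a ha b hb => ?_⟩
  rcases lt_trichotomy (toLex (entry (Denumerable.ofNat (List ℕ) a)))
    (toLex (entry (Denumerable.ofNat (List ℕ) b))) with h | h | h
  · exact .inr (.inl ⟨⟨ha, hb⟩, h⟩)
  · have := entry_injective (toLex.injective h)
    exact .inl (by simpa using congrArg Encodable.encode this)
  · exact .inr (.inr ⟨⟨hb, ha⟩, h⟩)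

theorem exists_computable_decider {α : Type} [Primcodable α] {p : α → Prop}
    (hp : PrimrecPred p) : ∃ χ : α → Bool, Computable χ ∧ ∀ a, p a ↔ χ a = true := by
  obtain ⟨_, h⟩ := hp
  exact ⟨_, h.to_comp, by simp⟩

theorem kbOrd_computable {T : Set (List ℕ)} (hT : PrimrecPred (· ∈ T)) :
    ComputableLinOrd (kbOrd T) := by
  have hdom : PrimrecPred fun a : ℕ => Denumerable.ofNat (List ℕ) a ∈ T :=
    hT.comp (Primrec.ofNat _)
  have hlt : PrimrecPred fun p : ℕ × ℕ => (kbOrd T).lt p.1 p.2 :=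
    ((hdom.comp Primrec.fst).and (hdom.comp Primrec.snd)).and
      (primrecRel_kb.comp ((Primrec.ofNat _).comp Primrec.fst)
        ((Primrec.ofNat _).comp Primrec.snd))
  obtain ⟨χ, hχ, hχ'⟩ := exists_computable_decider hlt
  exact ⟨kbOrd_isValid T, exists_computable_decider hdom,
    fun a b => χ (a, b), hχ, fun a b => hχ' (a, b)⟩

theorem entry_map_range_of_lt {p : ℕ → ℕ} {k i : ℕ} (h : i < k) :
    entry ((List.range k).map p) i = p i :=
  entry_eq_coe_iff.2 (by simp [h])

theorem isDescSeq_of_isPath {T : Set (List ℕ)} {p : ℕ → ℕ} (hp : IsPath T p) :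
    IsDescSeq (kbOrd T) fun n => Encodable.encode ((List.range n).map p) := by
  have hmem : ∀ n, (List.range n).map p ∈ T := hp
  refine fun n => ⟨by simpa [kbOrd] using hmem n,
    ⟨by simpa using hmem (n + 1), by simpa using hmem n⟩, ?_⟩
  simp only [Denumerable.ofNat_encode]
  refine toLex_lt_toLex_iff.2 ⟨n, fun j hj => ?_, ?_⟩
  · rw [entry_map_range_of_lt hj, entry_map_range_of_lt (hj.trans n.lt_succ_self)]
  · rw [entry_map_range_of_lt n.lt_succ_self, entry_of_le (by simp)]
    exact WithTop.coe_lt_top _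

/-- A tight descending sequence in the Kleene–Brouwer order on a tree converges to the leftmost
path. -/
theorem tight_converges_leftmost {T : Set (List ℕ)} (hT : PrefixClosed T) {f : ℕ → ℕ}
    (hf : IsTightDescSeq (kbOrd T) f) :
    ∃ p : ℕ → ℕ, IsPath T p ∧ (∀ q, IsPath T q → toLex p ≤ toLex q) ∧
      ∀ i, ∃ M, ∀ m ≥ M, (Denumerable.ofNat (List ℕ) (f m)).getD i 0 = p i := by
  set s : ℕ → List ℕ := fun m => Denumerable.ofNat (List ℕ) (f m)
  have hanti : StrictAnti fun m => toLex (entry (s m)) :=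
    strictAnti_nat_of_succ_lt fun m => (hf.1 m).2.2
  obtain ⟨p, hp⟩ := kb_desc_converges (s := s) fun m => (hf.1 m).2.2
  refine ⟨p, fun k => ?_, fun q hq => ?_, fun i => ?_⟩
  · obtain ⟨M, hM⟩ := hp k
    have hM := hM M le_rfl
    refine hT (s M) (hf.1 M).1 _ ?_
    have hlen : k ≤ (s M).length := by
      by_contra! h
      exact absurd (entry_eq_coe_iff.1 (hM _ h)).1 (lt_irrefl _)
    convert (s M).take_prefix k using 1
    refine List.ext_getElem (by simpa using hlen) fun i h₁ h₂ => ?_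
    have hi : i < k := by simpa using h₁
    have := (entry_eq_coe_iff.1 (hM i hi)).2
    rw [List.getD_eq_getElem _ _ (hi.trans_le hlen)] at this
    simpa using this.symm
  · by_contra! hlt
    obtain ⟨k, hk, hk'⟩ := toLex_lt_toLex_iff.1 hlt
    obtain ⟨m₀, hm₀⟩ := hf.2 _ (isDescSeq_of_isPath hq) (k + 1)
    obtain ⟨M, hM⟩ := hp (k + 1)
    have hM := hM (max M m₀) (le_max_left _ _)
    have h₁ : toLex (entry (s (max M m₀))) < toLex (entry ((List.range (k + 1)).map q)) :=
      (hanti.antitone (le_max_right _ _)).trans_lt (by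
        have := hm₀.2
        rwa [Denumerable.ofNat_encode] at this)
    refine lt_asymm h₁ (toLex_lt_toLex_iff.2 ⟨k, fun j hj => ?_, ?_⟩)
    · rw [hM j (by omega), entry_map_range_of_lt (by omega), hk j hj]
    · rw [hM k (by omega), entry_map_range_of_lt (by omega)]
      exact WithTop.coe_lt_coe.2 hk'
  · obtain ⟨M, hM⟩ := hp (i + 1)
    exact ⟨M, fun m hm => (entry_eq_coe_iff.1 (hM m hm i i.lt_succ_self)).2⟩

/-! ### A tree whose leftmost path decides a `Σ¹₁` set -/

/-- The tree of finite sequences that are split into columns by the pairing function, where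
column `e` consists of a flag followed, if the flag is `0`, by an attempt to build a sequence
all of whose initial segments satisfy `R e`. -/
def columnTree (R : ℕ → List ℕ → Prop) : Set (List ℕ) :=
  {σ | ∀ i < σ.length, σ.getD (Nat.pair i.unpair.1 0) 0 ≠ 0 ∨
    R i.unpair.1 ((List.range i.unpair.2).map fun j => σ.getD (Nat.pair i.unpair.1 (j + 1)) 0)}

theorem pair_le_pair_right (e : ℕ) {j k : ℕ} (h : j ≤ k) : Nat.pair e j ≤ Nat.pair e k :=
  h.eq_or_lt.elim (fun h => h ▸ le_rfl) fun h => (Nat.pair_lt_pair_right e h).le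

theorem columnTree_mem_iff {R : ℕ → List ℕ → Prop} {σ : List ℕ} {p : ℕ → ℕ}
    (h : ∀ i < σ.length, σ.getD i 0 = p i) :
    σ ∈ columnTree R ↔ ∀ e j, Nat.pair e j < σ.length → p (Nat.pair e 0) ≠ 0 ∨
      R e ((List.range j).map fun j => p (Nat.pair e (j + 1))) := by
  have key : ∀ e j, Nat.pair e j < σ.length →
      (σ.getD (Nat.pair e 0) 0 ≠ 0 ∨
        R e ((List.range j).map fun j => σ.getD (Nat.pair e (j + 1)) 0) ↔
      p (Nat.pair e 0) ≠ 0 ∨ R e ((List.range j).map fun j => p (Nat.pair e (j + 1)))) := by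
    intro e j hj
    rw [h _ ((pair_le_pair_right e j.zero_le).trans_lt hj)]
    have : ((List.range j).map fun j => σ.getD (Nat.pair e (j + 1)) 0) =
        (List.range j).map fun j => p (Nat.pair e (j + 1)) :=
      List.map_congr_left fun i hi =>
        h _ ((pair_le_pair_right e (List.mem_range.1 hi)).trans_lt hj)
    rw [this]
  constructor
  · intro hσ e j hj
    have := hσ _ hj
    rw [Nat.unpair_pair] at this
    exact (key e j hj).1 this
  · intro hσ i hi
    have hi' : Nat.pair i.unpair.1 i.unpair.2 < σ.length := by rwa [Nat.pair_unpair]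
    exact (key _ _ hi').2 (hσ _ _ hi')

theorem columnTree_prefixClosed (R : ℕ → List ℕ → Prop) : PrefixClosed (columnTree R) := by
  rintro _ hσ τ ⟨ρ, rfl⟩
  rw [columnTree_mem_iff (p := fun i => (τ ++ ρ).getD i 0) fun _ _ => rfl] at hσ
  rw [columnTree_mem_iff (p := fun i => (τ ++ ρ).getD i 0)
    fun i hi => (List.getD_append _ _ _ _ hi).symm]
  exact fun e j hj => hσ e j (hj.trans_le (by simp))

theorem columnTree_isPath_iff {R : ℕ → List ℕ → Prop} {p : ℕ → ℕ} :
    IsPath (columnTree R) p ↔ ∀ e j, p (Nat.pair e 0) ≠ 0 ∨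
      R e ((List.range j).map fun j => p (Nat.pair e (j + 1))) := by
  have h : ∀ k, ∀ i < ((List.range k).map p).length, ((List.range k).map p).getD i 0 = p i := by
    intro k i hi
    have hi : i < k := by simpa using hi
    simp [hi]
  constructor
  · intro hp e j
    exact (columnTree_mem_iff (h _)).1 (hp (Nat.pair e j + 1)) e j (by simp)
  · exact fun hp k => (columnTree_mem_iff (h k)).2 fun e j _ => hp e j

theorem columnTree_leftmost {R : ℕ → List ℕ → Prop} {p : ℕ → ℕ}
    (hp : IsPath (columnTree R) p)
    (hleft : ∀ q, IsPath (columnTree R) q → toLex p ≤ toLex q) (e : ℕ) :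
    p (Nat.pair e 0) = 0 ↔ ∃ f : ℕ → ℕ, ∀ k, R e ((List.range k).map f) := by
  rw [columnTree_isPath_iff] at hp
  refine ⟨fun h => ⟨_, fun k => (hp e k).resolve_left (not_not.2 h)⟩, fun ⟨f, hf⟩ => ?_⟩
  by_contra hpe
  set q : ℕ → ℕ := fun i =>
    if i.unpair.1 = e then (if i.unpair.2 = 0 then 0 else f (i.unpair.2 - 1)) else p i with hqdef
  have hq : IsPath (columnTree R) q := by
    rw [columnTree_isPath_iff]
    intro e' j
    by_cases he : e' = e
    · subst he
      exact .inr (by simpa [hqdef] using hf j)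
    · simpa [hqdef, he] using hp e' j
  refine (hleft q hq).not_gt ⟨Nat.pair e 0, fun i hi => ?_, ?_⟩
  · have : i.unpair.1 ≠ e := by
      rintro rfl
      have := pair_le_pair_right i.unpair.1 i.unpair.2.zero_le
      rw [Nat.pair_unpair] at this
      exact absurd hi this.not_gt
    simp [hqdef, this]
  · simpa [hqdef] using Nat.pos_of_ne_zero hpe

theorem columnTree_primrec {R : ℕ → List ℕ → Prop} (hR : PrimrecRel R) :
    PrimrecPred (· ∈ columnTree R) := by
  have hget : Primrec fun a : (ℕ × List ℕ) × ℕ =>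
      a.1.2.getD (Nat.pair a.1.1.unpair.1 a.2) 0 :=
    (Primrec.list_getD 0).comp (Primrec.snd.comp Primrec.fst)
      (Primrec₂.natPair.comp
        (Primrec.fst.comp (Primrec.unpair.comp (Primrec.fst.comp Primrec.fst))) Primrec.snd)
  have hcol : Primrec fun a : ℕ × List ℕ =>
      (List.range a.1.unpair.2).map fun j => a.2.getD (Nat.pair a.1.unpair.1 (j + 1)) 0 :=
    Primrec.list_map (Primrec.list_range.comp
      (Primrec.snd.comp (Primrec.unpair.comp Primrec.fst)))
      (hget.comp (Primrec.fst.pair (Primrec.succ.comp Primrec.snd)))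
  have hstage : PrimrecRel fun (i : ℕ) (σ : List ℕ) =>
      σ.getD (Nat.pair i.unpair.1 0) 0 ≠ 0 ∨ R i.unpair.1
        ((List.range i.unpair.2).map fun j => σ.getD (Nat.pair i.unpair.1 (j + 1)) 0) :=
    PrimrecPred.or
      (PrimrecPred.not (Primrec.eq.comp
        (hget.comp (Primrec.id.pair (Primrec.const 0))) (Primrec.const 0)))
      (hR.comp (Primrec.fst.comp (Primrec.unpair.comp Primrec.fst)) hcol)
  exact (primrecRel_forall_lt hstage).comp Primrec.list_length (Primrec.id (α := List ℕ))

/-- If `X` is high for tight descending sequences, then it limit-computes every `Σ¹₁` set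
given by a primitive recursive matrix. -/
theorem HighForTightDS.limit_computes {X : Set ℕ} (h : HighForTightDS X)
    {R : ℕ → List ℕ → Prop} (hR : PrimrecRel R) :
    ∃ g : ℕ × ℕ → ℕ, ComputableIn (chi X) g ∧ ∀ e, ∃ s₀, ∀ s, s₀ ≤ s →
      g (e, s) = chi {e | ¬ ∃ f : ℕ → ℕ, ∀ k, R e ((List.range k).map f)} e := by
  have hpath : IsPath (columnTree R) fun _ => 1 :=
    columnTree_isPath_iff.2 fun _ _ => .inl one_ne_zero
  obtain ⟨f, hf, htight⟩ := h (kbOrd (columnTree R)) (kbOrd_computable (columnTree_primrec hR))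
    ⟨_, isDescSeq_of_isPath hpath⟩
  obtain ⟨p, hp, hleft, hlim⟩ :=
    tight_converges_leftmost (columnTree_prefixClosed R) htight
  have hG : Primrec₂ fun e a : ℕ =>
      if (Denumerable.ofNat (List ℕ) a).getD (Nat.pair e 0) 0 = 0 then 0 else 1 :=
    Primrec.ite (Primrec.eq.comp ((Primrec.list_getD 0).comp
      ((Primrec.ofNat _).comp Primrec.snd)
      (Primrec₂.natPair.comp Primrec.fst (Primrec.const 0))) (Primrec.const 0))
      (Primrec.const 0) (Primrec.const 1)
  refine ⟨_, hf.postcomp hG.to_comp, fun e => ?_⟩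
  obtain ⟨M, hM⟩ := hlim (Nat.pair e 0)
  refine ⟨M, fun s hs => ?_⟩
  have := columnTree_leftmost hp hleft e
  simp only [hM s hs, chi, Set.mem_ofPred_eq, ← this, ite_not]

/-! ### Ill-foundedness of computable trees in normal form -/

/-- The last entry of `l` codes a value `y` and a stage bound `t`; by stage `t`, the computation
of index `e` on input `l.length - 1` has converged and has not violated prefix-closure, and the
sequence of values before the last one has been accepted. -/
def PathWitness (e : ℕ) (l : List ℕ) : Prop :=
  l.length = 0 ∨
    ((Code.evaln (l.getD (l.length - 1) 0).unpair.2 (Denumerable.ofNat Code e) (l.length - 1)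
        ≠ none ∧
      (¬ Code.evaln (l.getD (l.length - 1) 0).unpair.2 (Denumerable.ofNat Code e) (l.length - 1)
          = some 1 ∨
        Code.evaln (l.getD (l.length - 1) 0).unpair.2 (Denumerable.ofNat Code e)
          (Encodable.encode (Denumerable.ofNat (List ℕ) (l.length - 1)).dropLast) = some 1)) ∧
      Code.evaln (l.getD (l.length - 1) 0).unpair.2 (Denumerable.ofNat Code e)
        (Encodable.encode ((l.map fun x => x.unpair.1).take (l.length - 1))) = some 1)

theorem primrecRel_pathWitness : PrimrecRel PathWitness := by
  have hl : Primrec fun a : ℕ × List ℕ => a.2.length := Primrec.list_length.comp Primrec.snd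
  have hn : Primrec fun a : ℕ × List ℕ => a.2.length - 1 := Primrec.pred.comp hl
  have ht : Primrec fun a : ℕ × List ℕ => (a.2.getD (a.2.length - 1) 0).unpair.2 :=
    Primrec.snd.comp (Primrec.unpair.comp ((Primrec.list_getD 0).comp Primrec.snd hn))
  have hev : ∀ {i : ℕ × List ℕ → ℕ}, Primrec i → Primrec fun a : ℕ × List ℕ =>
      Code.evaln (a.2.getD (a.2.length - 1) 0).unpair.2 (Denumerable.ofNat Code a.1) (i a) :=
    fun hi => Code.primrec_evaln.comp
      ((ht.pair ((Primrec.ofNat Code).comp Primrec.fst)).pair hi)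
  have hdrop : Primrec fun a : ℕ × List ℕ =>
      Encodable.encode (Denumerable.ofNat (List ℕ) (a.2.length - 1)).dropLast := by
    refine (Primrec.encode.comp (Primrec.list_reverse.comp (Primrec.list_tail.comp
      (Primrec.list_reverse.comp ((Primrec.ofNat (List ℕ)).comp hn))))).of_eq fun a => ?_
    simp
  have htake : Primrec fun a : ℕ × List ℕ =>
      Encodable.encode ((a.2.map fun x => x.unpair.1).take (a.2.length - 1)) :=
    Primrec.encode.comp (Primrec.list_take.comp hn
      (Primrec.list_map Primrec.snd (Primrec.fst.comp (Primrec.unpair.comp Primrec.snd))))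
  exact (Primrec.eq.comp hl (Primrec.const 0)).or
    (((Primrec.eq.comp (hev hn) (Primrec.const none)).not.and
      ((Primrec.eq.comp (hev hn) (Primrec.const (some 1))).not.or
        (Primrec.eq.comp (hev hdrop) (Primrec.const (some 1))))).and
      (Primrec.eq.comp (hev htake) (Primrec.const (some 1))))

theorem pathWitness_map_range_succ {e n : ℕ} {f : ℕ → ℕ} :
    PathWitness e ((List.range (n + 1)).map f) ↔
      ((Code.evaln (f n).unpair.2 (Denumerable.ofNat Code e) n ≠ none ∧
        (¬ Code.evaln (f n).unpair.2 (Denumerable.ofNat Code e) n = some 1 ∨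
          Code.evaln (f n).unpair.2 (Denumerable.ofNat Code e)
            (Encodable.encode (Denumerable.ofNat (List ℕ) n).dropLast) = some 1)) ∧
        Code.evaln (f n).unpair.2 (Denumerable.ofNat Code e)
          (Encodable.encode ((List.range n).map fun i => (f i).unpair.1)) = some 1) := by
  have h : ((List.range (n + 1)).map f).getD n 0 = f n := by simp
  have h' : ((((List.range (n + 1)).map f).map fun x => x.unpair.1).take n) =
      (List.range n).map fun i => (f i).unpair.1 := by
    rw [List.map_map, ← List.map_take, List.take_range, min_eq_left n.le_succ]
    rfl
  simp only [PathWitness, List.length_map, List.length_range, Nat.add_sub_cancel, h, h',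
    Nat.succ_ne_zero, false_or]

theorem prefixClosed_of_dropLast {T : Set (List ℕ)} (h : ∀ l ∈ T, l.dropLast ∈ T) :
    PrefixClosed T := by
  rintro _ hl l' ⟨r, rfl⟩
  induction r using List.reverseRecOn with
  | nil => simpa using hl
  | append_singleton r a ih =>
    refine ih ?_
    have := h _ hl
    rwa [← List.append_assoc, List.dropLast_concat] at this

theorem illFounded_treeAt_iff {e : ℕ} : IllFounded (treeAt e) ↔
    DecidesTree e ∧
      IllFounded {l : List ℕ | codeFn e (Encodable.encode l) = Part.some 1} := by
  unfold treeAt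
  split_ifs with h
  · simp [h]
  · simp only [h, false_and, iff_false]
    exact fun ⟨f, hf⟩ => hf 0

theorem codeFn_eq_some_iff {e n a : ℕ} : codeFn e n = Part.some a ↔
    ∃ t, Code.evaln t (Denumerable.ofNat Code e) n = some a := by
  rw [Part.eq_some_iff]
  exact Code.evaln_complete

theorem illFounded_treeAt_iff_pathWitness {e : ℕ} : IllFounded (treeAt e) ↔
    ∃ f : ℕ → ℕ, ∀ k, PathWitness e ((List.range k).map f) := by
  set c := Denumerable.ofNat Code e
  rw [illFounded_treeAt_iff]
  constructor
  · rintro ⟨⟨htot, hpre⟩, y, hy⟩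
    have hmono : ∀ {t u n a}, Code.evaln t c n = some a → t ≤ u → Code.evaln u c n = some a :=
      fun h htu => Code.evaln_mono htu h
    have hstage : ∀ n, ∃ t, (Code.evaln t c n ≠ none ∧ (¬ Code.evaln t c n = some 1 ∨
        Code.evaln t c (Encodable.encode (Denumerable.ofNat (List ℕ) n).dropLast) = some 1)) ∧
        Code.evaln t c (Encodable.encode ((List.range n).map y)) = some 1 := by
      intro n
      obtain ⟨a, ha⟩ := Part.dom_iff_mem.1 (htot n)
      obtain ⟨t₁, ht₁⟩ := codeFn_eq_some_iff.1 (Part.eq_some_iff.2 ha)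
      obtain ⟨t₂, ht₂⟩ := codeFn_eq_some_iff.1 (hy n)
      by_cases h1 : a = 1
      · subst h1
        have hmem : codeFn e (Encodable.encode (Denumerable.ofNat (List ℕ) n).dropLast) =
            Part.some 1 :=
          hpre (Denumerable.ofNat (List ℕ) n) (by simpa using Part.eq_some_iff.2 ha) _
            (List.dropLast_prefix _)
        obtain ⟨t₃, ht₃⟩ := codeFn_eq_some_iff.1 hmem
        refine ⟨max t₁ (max t₂ t₃), ⟨?_, .inr (hmono ht₃ (by simp))⟩, hmono ht₂ (by simp)⟩
        rw [hmono ht₁ (by simp)]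
        simp
      · refine ⟨max t₁ t₂, ⟨?_, .inl ?_⟩, hmono ht₂ (by simp)⟩ <;>
          rw [hmono ht₁ (by simp)] <;> simp [h1]
    choose t ht using hstage
    refine ⟨fun n => Nat.pair (y n) (t n), fun k => ?_⟩
    cases k with
    | zero => exact .inl rfl
    | succ n => simpa only [pathWitness_map_range_succ, Nat.unpair_pair] using ht n
  · rintro ⟨f, hf⟩
    have hf n := pathWitness_map_range_succ.1 (hf (n + 1))
    refine ⟨⟨fun n => ?_, prefixClosed_of_dropLast fun l hl => ?_⟩, fun i => (f i).unpair.1,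
      fun n => codeFn_eq_some_iff.2 ⟨_, (hf n).2⟩⟩
    · obtain ⟨a, ha⟩ := Option.ne_none_iff_exists'.1 (hf n).1.1
      exact Part.dom_iff_mem.2 ⟨a, Code.evaln_sound ha⟩
    · obtain ⟨a, ha⟩ := Option.ne_none_iff_exists'.1 (hf (Encodable.encode l)).1.1
      have : a = 1 := Part.mem_unique (Code.evaln_sound ha) (Part.eq_some_iff.1 hl)
      subst this
      have := (hf (Encodable.encode l)).1.2.resolve_left (not_not.2 ha)
      rw [Denumerable.ofNat_encode] at this
      exact codeFn_eq_some_iff.2 ⟨_, this⟩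

/-- If `X` is high for tight descending sequences, then `WF` is
limit-computable relative to `X`. -/
theorem highForTightDS_WF_limit_computable (X : Set ℕ) (h : HighForTightDS X) :
    ∃ g : ℕ × ℕ → ℕ, ComputableIn (chi X) g ∧
      ∀ e, ∃ s₀, ∀ s, s₀ ≤ s → g (e, s) = chi WF e := by
  have hWF : WF = {e | ¬ ∃ f : ℕ → ℕ, ∀ k, PathWitness e ((List.range k).map f)} :=
    Set.ext fun _ => not_congr illFounded_treeAt_iff_pathWitness
  rw [hWF]
  exact h.limit_computes primrecRel_pathWitness

end CFT
end
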